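/- Let t, L, K ≥ 1, Δ ≥ 1, Δ1 ≥ 0, Δ2 ≥ 1 and m ≥ 4L+2 be integers. Let G_1,…,G_K ∈ ℚ[Z_1,…,Z_L] have total degree at most Δ1, and let D ⊆ ℂ^L be any set belonging to the Boolean algebra of subsets of ℂ^L generated by the K zero sets {c ∈ ℂ^L : G_i(c) = 0}. For each exponent vector α ∈ ℕ^t with |α| ≤ Δ let Ω_α ∈ ℚ[Z_1,…,Z_L] have total degree at most Δ2, for c ∈ ℂ^L set Q_c := Σ_{|α|≤Δ} Ω_α(c)·Y^α ∈ ℂ[Y_1,…,Y_t], let O := {Q_c : c ∈ D}, and let Ō be the Zariski closure of O in the coefficient space of polynomials of total degree at most Δ in Y_1,…,Y_t. Let M ⊆ ℚ be a finite set with #M ≥ 2 and #M ≥ Δ²·(L+1)^{1/L}·(1+K·Δ1)·Δ2 (an inequality of real numbers). Then there exist points γ_1,…,γ_m ∈ M^t forming an identification sequence for Ō, i.e., any two polynomials F_1, F_2 ∈ Ō with F_1(γ_i) = F_2(γ_i) for all 1 ≤ i ≤ m satisfy F_1 = F_2; moreover the number of m-tuples (γ_1,…,γ_m) ∈ (M^t)^m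 that fail to be identification sequences for Ō is at most (#M)^{mt−1}. -/

import Mathlib

open scoped BigOperators

/-- A subset of `ℂ^ι` is Zariski closed if it is the common zero set of a family
of polynomials with complex coefficients. -/
def ZariskiClosed {ι : Type} (S : Set (ι → ℂ)) : Prop :=
  ∃ F : Set (MvPolynomial ι ℂ), S = {x : ι → ℂ | ∀ f ∈ F, MvPolynomial.eval x f = 0}

/-- The Zariski closure of a set: the intersection of all Zariski closed sets
containing it. -/
def zClosure {ι : Type} (S : Set (ι → ℂ)) : Set (ι → ℂ) :=
  ⋂₀ {C : Set (ι → ℂ) | ZariskiClosed C ∧ S ⊆ C}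

/-- Membership in the Boolean algebra of sets generated by a family `G`. -/
inductive InBoolAlg {α : Type*} (G : Set (Set α)) : Set α → Prop
  | basic (s : Set α) : s ∈ G → InBoolAlg G s
  | univ : InBoolAlg G Set.univ
  | compl (s : Set α) : InBoolAlg G s → InBoolAlg G sᶜ
  | inter (s u : Set α) : InBoolAlg G s → InBoolAlg G u → InBoolAlg G (s ∩ u)

/-- Evaluation of a coefficient vector (indexed by exponent vectors
`α : Fin t → Fin (Δ+1)`) at a point `y ∈ ℂ^t`: the value of the corresponding
polynomial `Σ_α v_α · y^α`. -/
noncomputable def evalVec {t Δ : ℕ} (v : (Fin t → Fin (Δ + 1)) → ℂ) (y : Fin t → ℂ) : ℂ :=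
  ∑ α : Fin t → Fin (Δ + 1), v α * ∏ i : Fin t, y i ^ (α i : ℕ)

/-- The object class `O = {Q_c : c ∈ D}`, where `Q_c` is the coefficient vector
`α ↦ Ω_α(c)`. -/
def objClass (t L Δ : ℕ) (D : Set (Fin L → ℂ))
    (Ω : (Fin t → Fin (Δ + 1)) → MvPolynomial (Fin L) ℚ) :
    Set ((Fin t → Fin (Δ + 1)) → ℂ) :=
  {v | ∃ c ∈ D, v = fun α => MvPolynomial.aeval c (Ω α)}

section
open Algebra Cardinal
lemma mem_vars_iff_degreeOf {σ : Type} (g : MvPolynomial σ ℂ) (i : σ) :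
    i ∈ g.vars ↔ g.degreeOf i ≠ 0 := by
  classical
  rw [MvPolynomial.degreeOf_def, MvPolynomial.vars_def, Multiset.mem_toFinset,
    Ne, Multiset.count_eq_zero, not_not]

open MvPolynomial in
lemma exists_degreeOf_ne_zero {n : ℕ} (g : MvPolynomial (Fin n) ℂ) (hg : Prime g) :
    ∃ k, g.degreeOf k ≠ 0 := by
  by_contra! h
  have hv : g.vars = ∅ := by
    ext i
    simp [mem_vars_iff_degreeOf, h i]
  have : g.totalDegree = 0 := by
    rw [MvPolynomial.totalDegree_eq_zero_iff]
    intro m hm x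
    by_contra hx
    have : x ∈ g.vars := (MvPolynomial.mem_vars_iff_mem_support x).2 ⟨m, hm, by simpa using hx⟩
    simp [hv] at this
  rw [MvPolynomial.totalDegree_eq_zero_iff_eq_C] at this
  rw [this] at hg
  have h0 : g.coeff 0 ≠ 0 := by
    intro h0; rw [h0] at hg; simp at hg
  exact hg.not_isUnit ((IsUnit.mk0 _ h0).map MvPolynomial.C)

open Cardinal in
lemma trdeg_hyp {n : ℕ} (g : MvPolynomial (Fin n) ℂ) (hg : Prime g) :
    Algebra.trdeg ℂ (MvPolynomial (Fin n) ℂ ⧸ Ideal.span {g}) + 1 = (n : Cardinal) := by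
  have hpr : (Ideal.span {g}).IsPrime := (Ideal.span_singleton_prime hg.ne_zero).2 hg
  obtain ⟨k, hk⟩ := exists_degreeOf_ne_zero g hg
  have hlow : ((n - 1 : ℕ) : Cardinal) ≤
      Algebra.trdeg ℂ (MvPolynomial (Fin n) ℂ ⧸ Ideal.span {g}) := by
    let x : {i : Fin n // i ≠ k} → (MvPolynomial (Fin n) ℂ ⧸ Ideal.span {g}) :=
      fun i => Ideal.Quotient.mkₐ ℂ _ (MvPolynomial.X i.1)
    have hx : AlgebraicIndependent ℂ x := by
      rw [algebraicIndependent_iff]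
      intro p hp
      have h1 : MvPolynomial.aeval x p =
        Ideal.Quotient.mkₐ ℂ (Ideal.span {g}) (MvPolynomial.rename Subtype.val p) := by
        have : (MvPolynomial.aeval x) =
          (Ideal.Quotient.mkₐ ℂ (Ideal.span {g})).comp (MvPolynomial.rename Subtype.val) := by
          ext i; simp [x]
        rw [this]; rfl
      rw [h1, Ideal.Quotient.mkₐ_eq_mk, Ideal.Quotient.eq_zero_iff_mem,
        Ideal.mem_span_singleton] at hp
      obtain ⟨q, hq⟩ := hp
      by_contra hp0
      have h2 : MvPolynomial.rename Subtype.val p ≠ 0 := fun h => hp0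
        (MvPolynomial.rename_injective _ Subtype.val_injective (by simpa using h))
      have hq0 : q ≠ 0 := by rintro rfl; rw [mul_zero] at hq; exact h2 hq
      have h3 : (MvPolynomial.rename Subtype.val p).degreeOf k = 0 := by
        by_contra h4
        have h5 := (mem_vars_iff_degreeOf _ k).2 h4
        have h6 := MvPolynomial.vars_rename _ _ h5
        simp at h6
      rw [hq, MvPolynomial.degreeOf_mul_eq hg.ne_zero hq0] at h3
      omega
    have := hx.cardinalMk_le_trdeg
    have hc : #{i : Fin n // i ≠ k} = ((n - 1 : ℕ) : Cardinal) := by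
      rw [Cardinal.mk_fintype]; simp
    rwa [hc] at this
  have hsurj : Function.Surjective (Ideal.Quotient.mkₐ ℂ (Ideal.span {g})) :=
    Ideal.Quotient.mkₐ_surjective _ _
  have hup : Algebra.trdeg ℂ (MvPolynomial (Fin n) ℂ ⧸ Ideal.span {g}) ≤ n := by
    have := trdeg_le_of_surjective _ hsurj
    simpa using this
  obtain ⟨e, he⟩ := Cardinal.lt_aleph0.1 (hup.trans_lt (Cardinal.natCast_lt_aleph0))
  have hne : e ≠ n := by
    intro h
    let x : Fin n → (MvPolynomial (Fin n) ℂ ⧸ Ideal.span {g}) :=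
      fun i => Ideal.Quotient.mkₐ ℂ _ (MvPolynomial.X i)
    have hae : MvPolynomial.aeval x = Ideal.Quotient.mkₐ ℂ (Ideal.span {g}) := by
      ext i; simp [x]
    have htop : Algebra.adjoin ℂ (Set.range x) = ⊤ := by
      rw [Algebra.adjoin_range_eq_range_aeval, hae]
      exact (AlgHom.range_eq_top _).2 hsurj
    have : Algebra.IsAlgebraic (Algebra.adjoin ℂ (Set.range x))
        (MvPolynomial (Fin n) ℂ ⧸ Ideal.span {g}) := by
      constructor
      intro a
      have : a ∈ Algebra.adjoin ℂ (Set.range x) := by rw [htop]; trivial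
      exact isAlgebraic_algebraMap (⟨a, this⟩ : Algebra.adjoin ℂ (Set.range x))
    have hb := Algebra.IsAlgebraic.isTranscendenceBasis_of_le_trdeg_of_finite ℂ x
      (by rw [he, h]; simp)
    have h1 := hb.1
    rw [algebraicIndependent_iff] at h1
    refine hg.ne_zero (h1 g ?_)
    rw [hae, Ideal.Quotient.mkₐ_eq_mk, Ideal.Quotient.eq_zero_iff_mem]
    exact Ideal.mem_span_singleton_self g
  rw [he] at hlow hup ⊢
  have h1 : n - 1 ≤ e := by exact_mod_cast hlow
  have h2 : e ≤ n := by exact_mod_cast hup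
  have : 0 < n := k.pos
  have : e + 1 = n := by omega
  exact_mod_cast this

lemma krull_alg {A : Type} [CommRing A] [IsDomain A] [Algebra ℂ A] [Algebra.FiniteType ℂ A]
    (x : A) (hx : x ≠ 0) (q : Ideal A) (hq : q ∈ (Ideal.span {x}).minimalPrimes) :
    Algebra.trdeg ℂ (A ⧸ q) + 1 = Algebra.trdeg ℂ A := by
  have : IsNoetherianRing A := Algebra.FiniteType.isNoetherianRing ℂ A
  have hqp : q.IsPrime := hq.1.1
  have hxq : x ∈ q := hq.1.2 (Ideal.mem_span_singleton_self x)
  obtain ⟨n, φ, hφ, hint⟩ := exists_integral_inj_algHom_of_fg ℂ A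
  let _ : Algebra (MvPolynomial (Fin n) ℂ) A := φ.toRingHom.toAlgebra
  have : IsScalarTower ℂ (MvPolynomial (Fin n) ℂ) A := IsScalarTower.of_algHom φ
  have : Algebra.IsIntegral (MvPolynomial (Fin n) ℂ) A := ⟨hint⟩
  have : FaithfulSMul (MvPolynomial (Fin n) ℂ) A :=
    (faithfulSMul_iff_algebraMap_injective _ _).2 hφ
  have hA : Algebra.trdeg ℂ A = n := by
    rw [← trdeg_add_eq ℂ (MvPolynomial (Fin n) ℂ) (A := A),
      trdeg_eq_zero (R := MvPolynomial (Fin n) ℂ) (A := A)]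
    simp
  have hp0 : q.under (MvPolynomial (Fin n) ℂ) ≠ ⊥ :=
    Ideal.comap_ne_bot_of_integral_mem hx hxq (Algebra.IsIntegral.isIntegral x)
  have hpp : (q.under (MvPolynomial (Fin n) ℂ)).IsPrime := inferInstance
  obtain ⟨g, hgm, hg⟩ := hpp.exists_mem_prime_of_ne_bot hp0
  have hgp : (Ideal.span {g}).IsPrime := (Ideal.span_singleton_prime hg.ne_zero).2 hg
  have hle : Ideal.span {g} ≤ q.under (MvPolynomial (Fin n) ℂ) := by
    rwa [Ideal.span_singleton_le_iff_mem]
  have heq : Ideal.span {g} = q.under (MvPolynomial (Fin n) ℂ) := by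
    by_contra hne
    obtain ⟨P, hPq, hPp, hPl⟩ := Ideal.exists_ideal_lt_liesOver_of_lt q (lt_of_le_of_ne hle hne)
    have h0P : (⊥ : Ideal A) < P := by
      rw [bot_lt_iff_ne_bot]
      rintro rfl
      have : g ∈ Ideal.span {g} := Ideal.mem_span_singleton_self g
      rw [hPl.over] at this
      have : algebraMap (MvPolynomial (Fin n) ℂ) A g = 0 := by simpa using this
      exact hg.ne_zero (hφ (by rw [map_zero]; exact this))
    have h1 := Ideal.height_add_one_le_of_lt_of_isPrime h0P
    have h2 := Ideal.height_add_one_le_of_lt_of_isPrime hPq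
    have h3 := Ideal.height_le_one_of_isPrincipal_of_mem_minimalPrimes _ _ hq
    have h4 : (1 : ℕ∞) + 1 ≤ 1 :=
      calc (1 : ℕ∞) + 1 ≤ P.height + 1 := by
            gcongr; exact le_trans (by simp) h1
        _ ≤ q.height := h2
        _ ≤ 1 := h3
    exact absurd h4 (by norm_num)
  have : q.LiesOver (Ideal.span {g}) := ⟨heq⟩
  have h5 := trdeg_hyp g hg
  have : FaithfulSMul (MvPolynomial (Fin n) ℂ ⧸ Ideal.span {g}) (A ⧸ q) :=
    inferInstance
  have : Algebra.IsIntegral (MvPolynomial (Fin n) ℂ ⧸ Ideal.span {g}) (A ⧸ q) := inferInstance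
  have : IsScalarTower ℂ (MvPolynomial (Fin n) ℂ ⧸ Ideal.span {g}) (A ⧸ q) := inferInstance
  rw [hA, ← h5, ← trdeg_add_eq ℂ (MvPolynomial (Fin n) ℂ ⧸ Ideal.span {g}) (A := A ⧸ q),
    trdeg_eq_zero (R := MvPolynomial (Fin n) ℂ ⧸ Ideal.span {g}) (A := A ⧸ q), add_zero]

/-- dimension of a prime -/
noncomputable def pdim {σ : Type} (P : Ideal (MvPolynomial σ ℂ)) : ℕ :=
  Cardinal.toNat (Algebra.trdeg ℂ (MvPolynomial σ ℂ ⧸ P))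

lemma krull {σ : Type} [Finite σ] (P : Ideal (MvPolynomial σ ℂ)) (hP : P.IsPrime)
    (f : MvPolynomial σ ℂ) (hf : f ∉ P) (Q : Ideal (MvPolynomial σ ℂ))
    (hQ : Q ∈ (P ⊔ Ideal.span {f}).minimalPrimes) : pdim Q + 1 = pdim P := by
  have hPQ : P ≤ Q := le_sup_left.trans hQ.1.2
  have hQp : Q.IsPrime := hQ.1.1
  let A := MvPolynomial σ ℂ ⧸ P
  let q : Ideal A := Q.map (Ideal.Quotient.mkₐ ℂ P)
  have hsurj : Function.Surjective (Ideal.Quotient.mkₐ ℂ P) := Ideal.Quotient.mkₐ_surjective _ _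
  have hker : RingHom.ker (Ideal.Quotient.mkₐ ℂ P) = P := Ideal.Quotient.mkₐ_ker ℂ P
  have hcom : q.comap (Ideal.Quotient.mkₐ ℂ P) = Q := by
    rw [Ideal.comap_map_of_surjective' _ hsurj, hker, sup_eq_left.2 hPQ]
  have hqm : q ∈ (Ideal.span {Ideal.Quotient.mkₐ ℂ P f}).minimalPrimes := by
    refine ⟨⟨Ideal.map_isPrime_of_surjective hsurj (by rw [hker]; exact hPQ), ?_⟩, ?_⟩
    · rw [Ideal.span_singleton_le_iff_mem]
      exact Ideal.mem_map_of_mem _ (hQ.1.2 (le_sup_right (a := P) (Ideal.mem_span_singleton_self f)))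
    · rintro r ⟨hr, hfr⟩ hrq
      rw [Ideal.span_singleton_le_iff_mem] at hfr
      have h1 : Q ≤ r.comap (Ideal.Quotient.mkₐ ℂ P) := by
        apply hQ.2
        · refine ⟨inferInstance, sup_le ?_ ?_⟩
          · intro a ha
            have : Ideal.Quotient.mkₐ ℂ P a = 0 := by
              rwa [← RingHom.mem_ker, hker]
            simp only [Ideal.mem_comap, this, zero_mem]
          · rw [Ideal.span_singleton_le_iff_mem]; exact hfr
        · rw [← hcom]; exact Ideal.comap_mono hrq
      exact Ideal.map_le_iff_le_comap.2 h1
  have hx : Ideal.Quotient.mkₐ ℂ P f ≠ 0 := by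
    rw [Ne, ← RingHom.mem_ker, hker]; exact hf
  have h := krull_alg _ hx q hqm
  rw [(DoubleQuot.quotQuotEquivQuotOfLEₐ ℂ hPQ).trdeg_eq] at h
  have hlt : Algebra.trdeg ℂ (MvPolynomial σ ℂ ⧸ Q) < Cardinal.aleph0 :=
    trdeg_lt_aleph0_of_finiteType
  unfold pdim
  rw [← h, Cardinal.toNat_add hlt Cardinal.one_lt_aleph0, map_one]
end

section
open MvPolynomial

variable {σ : Type}

lemma finrank_range_le_of_ker_le {U X Y : Type} [AddCommGroup U] [Module ℂ U]
    [FiniteDimensional ℂ U] [AddCommGroup X] [Module ℂ X] [AddCommGroup Y] [Module ℂ Y]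
    (a : U →ₗ[ℂ] X) (b : U →ₗ[ℂ] Y) (h : LinearMap.ker a ≤ LinearMap.ker b) :
    Module.finrank ℂ (LinearMap.range b) ≤ Module.finrank ℂ (LinearMap.range a) := by
  have h1 := LinearMap.finrank_range_add_finrank_ker a
  have h2 := LinearMap.finrank_range_add_finrank_ker b
  have h3 := Submodule.finrank_mono h
  omega

/-- Hilbert function of an ideal (affine) -/
noncomputable def hilb (I : Ideal (MvPolynomial σ ℂ)) (s : ℕ) : ℕ :=
  Module.finrank ℂ ((restrictTotalDegree σ ℂ s).map (I.restrictScalars ℂ).mkQ)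

lemma hilb_mono [Finite σ] (I : Ideal (MvPolynomial σ ℂ)) {s s' : ℕ} (h : s ≤ s') :
    hilb I s ≤ hilb I s' := by
  apply Submodule.finrank_mono
  apply Submodule.map_mono
  intro p hp
  rw [mem_restrictTotalDegree] at hp ⊢
  exact hp.trans h

lemma hilb_anti [Finite σ] {I J : Ideal (MvPolynomial σ ℂ)} (h : I ≤ J) (s : ℕ) :
    hilb J s ≤ hilb I s := by
  unfold hilb
  rw [← LinearMap.range_domRestrict, ← LinearMap.range_domRestrict]
  apply finrank_range_le_of_ker_le
  intro x hx
  simp only [LinearMap.mem_ker, LinearMap.domRestrict_apply, Submodule.mkQ_apply,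
    Submodule.Quotient.mk_eq_zero] at hx ⊢
  exact h hx

lemma hilb_H [Finite σ] {I J Q : Ideal (MvPolynomial σ ℂ)} (hIJ : I ≤ J) (hIQ : I ≤ Q)
    (hQ : Q.IsPrime) (f : MvPolynomial σ ℂ) (hfJ : f ∈ J) (hfQ : f ∉ Q) (c : ℕ)
    (hc : f.totalDegree ≤ c) (s : ℕ) :
    hilb J (s + c) + hilb Q s ≤ hilb I (s + c) := by
  set V := (restrictTotalDegree σ ℂ (s + c)).map (I.restrictScalars ℂ).mkQ with hV
  let p : (MvPolynomial σ ℂ ⧸ (I.restrictScalars ℂ)) →ₗ[ℂ] (MvPolynomial σ ℂ ⧸ (J.restrictScalars ℂ)) :=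
    Submodule.mapQ _ _ LinearMap.id (by intro x hx; exact hIJ hx)
  have hpm : p ∘ₗ (I.restrictScalars ℂ).mkQ = (J.restrictScalars ℂ).mkQ := by
    refine LinearMap.ext fun x => ?_
    rfl
  have h1 := LinearMap.finrank_range_add_finrank_ker (p.domRestrict V)
  have h2 : LinearMap.range (p.domRestrict V) =
      (restrictTotalDegree σ ℂ (s + c)).map (J.restrictScalars ℂ).mkQ := by
    rw [LinearMap.range_domRestrict, hV, ← Submodule.map_comp, hpm]
  rw [h2] at h1
  let μ : MvPolynomial σ ℂ →ₗ[ℂ] (MvPolynomial σ ℂ ⧸ (I.restrictScalars ℂ)) :=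
    (I.restrictScalars ℂ).mkQ ∘ₗ LinearMap.mulLeft ℂ f
  let W := (restrictTotalDegree σ ℂ s).map μ
  have hWV : W ≤ V := by
    rintro _ ⟨x, hx, rfl⟩
    refine ⟨f * x, ?_, rfl⟩
    simp only [SetLike.mem_coe, mem_restrictTotalDegree] at hx ⊢
    exact (totalDegree_mul _ _).trans (by omega)
  have hWk : W.comap V.subtype ≤ LinearMap.ker (p.domRestrict V) := by
    rintro ⟨x, hxV⟩ ⟨y, hy, hyx⟩
    simp only [LinearMap.mem_ker, LinearMap.domRestrict_apply]
    simp only [Submodule.subtype_apply] at hyx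
    rw [← hyx]
    show (Submodule.Quotient.mk (f * y) : MvPolynomial σ ℂ ⧸ (J.restrictScalars ℂ)) = 0
    rw [Submodule.Quotient.mk_eq_zero]
    exact J.mul_mem_right _ hfJ
  have h3 := Submodule.finrank_mono hWk
  have h4 : Module.finrank ℂ (W.comap V.subtype) = Module.finrank ℂ W :=
    (Submodule.comapSubtypeEquivOfLe hWV).finrank_eq
  have h5 : hilb Q s ≤ Module.finrank ℂ W := by
    unfold hilb
    have hW : W = LinearMap.range (μ.domRestrict (restrictTotalDegree σ ℂ s)) :=
      (LinearMap.range_domRestrict _ _).symm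
    rw [← LinearMap.range_domRestrict, hW]
    apply finrank_range_le_of_ker_le
    intro x hx
    simp only [LinearMap.mem_ker, LinearMap.domRestrict_apply, Submodule.mkQ_apply, μ,
      LinearMap.comp_apply, LinearMap.mulLeft_apply,
      Submodule.Quotient.mk_eq_zero] at hx ⊢
    exact (hQ.mem_or_mem (hIQ hx)).resolve_left hfQ
  unfold hilb at h5 ⊢
  rw [← hV]
  omega

/-- growth -/
def Growth (I : Ideal (MvPolynomial σ ℂ)) (δ : ℝ) (d : ℕ) : Prop :=
  ∃ c : ℕ, ∀ s : ℕ, δ * ((s + d).choose d : ℝ) ≤ hilb I (s + c)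

lemma Growth.of_le [Finite σ] {I J : Ideal (MvPolynomial σ ℂ)} {δ δ' : ℝ} {d : ℕ} (h : Growth J δ d)
    (hIJ : I ≤ J) (hδ : δ' ≤ δ) : Growth I δ' d := by
  obtain ⟨c, hc⟩ := h
  refine ⟨c, fun s => ?_⟩
  refine le_trans ?_ ((hc s).trans (by exact_mod_cast hilb_anti hIJ _))
  gcongr

lemma Growth.inf [Finite σ] (T : Finset (Ideal (MvPolynomial σ ℂ)))
    (hT : ∀ Q ∈ T, Q.IsPrime) (hanti : ∀ Q ∈ T, ∀ Q' ∈ T, Q ≤ Q' → Q = Q')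
    (δ : Ideal (MvPolynomial σ ℂ) → ℝ) (d : ℕ) (hg : ∀ Q ∈ T, Growth Q (δ Q) d) :
    Growth (T.inf id) (∑ Q ∈ T, δ Q) d := by
  classical
  induction T using Finset.induction_on with
  | empty => exact ⟨0, fun s => by simp⟩
  | insert Q T hQT ih =>
    have ih := ih (fun q hq => hT q (Finset.mem_insert_of_mem hq))
      (fun q hq q' hq' => hanti q (Finset.mem_insert_of_mem hq) q' (Finset.mem_insert_of_mem hq'))
      (fun q hq => hg q (Finset.mem_insert_of_mem hq))
    have hQ := hT Q (Finset.mem_insert_self _ _)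
    have hn : ¬ (T.inf id ≤ Q) := by
      intro h
      rw [Ideal.IsPrime.inf_le' hQ] at h
      obtain ⟨q, hq, hqQ⟩ := h
      have := hanti q (Finset.mem_insert_of_mem hq) Q (Finset.mem_insert_self _ _) hqQ
      exact hQT (this ▸ hq)
    obtain ⟨f, hfT, hfQ⟩ := SetLike.not_le_iff_exists.1 hn
    obtain ⟨c1, h1⟩ := ih
    obtain ⟨c2, h2⟩ := hg Q (Finset.mem_insert_self _ _)
    refine ⟨c1 + c2 + f.totalDegree, fun s => ?_⟩
    rw [Finset.sum_insert hQT, Finset.inf_insert, id, add_mul]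
    have h3 := hilb_H (inf_le_right : Q ⊓ T.inf id ≤ _) inf_le_left hQ f hfT hfQ
      f.totalDegree le_rfl (s + (c1 + c2))
    have h4 := h1 s
    have h5 := h2 s
    have h6 := hilb_mono (T.inf id) (show s + c1 ≤ s + (c1 + c2) + f.totalDegree by omega)
    have h7 := hilb_mono Q (show s + c2 ≤ s + (c1 + c2) by omega)
    have h8 : ((hilb (T.inf id) (s + c1) + hilb Q (s + c2) : ℕ) : ℝ) ≤
        hilb (Q ⊓ T.inf id) (s + (c1 + c2) + f.totalDegree) := by
      exact_mod_cast (by omega)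
    push_cast at h8
    rw [← add_assoc s]
    linarith

lemma Growth.cut [Finite σ] (P : Ideal (MvPolynomial σ ℂ)) (hP : P.IsPrime)
    (f : MvPolynomial σ ℂ) (hf : f ∉ P) (hd : f.totalDegree ≤ 1) (δ : ℝ) (d : ℕ)
    (hg : Growth (P ⊔ Ideal.span {f}) δ d) : Growth P δ (d + 1) := by
  obtain ⟨c, hc⟩ := hg
  refine ⟨c, fun s => ?_⟩
  have hH := hilb_H (le_sup_left : P ≤ P ⊔ Ideal.span {f}) le_rfl hP f
    (le_sup_right (a := P) (Ideal.mem_span_singleton_self f)) hf 1 hd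
  induction s with
  | zero =>
    have h1 := hc 0
    have h2 : (hilb (P ⊔ Ideal.span {f}) (0 + c) : ℝ) ≤ hilb P (0 + c) := by
      exact_mod_cast hilb_anti le_sup_left _
    simp only [zero_add, Nat.choose_self, Nat.cast_one, mul_one] at h1 h2 ⊢
    linarith
  | succ s ih =>
    have h1 := hc (s + 1)
    have h2 : ((hilb (P ⊔ Ideal.span {f}) (s + c + 1) + hilb P (s + c) : ℕ) : ℝ) ≤
      hilb P (s + c + 1) := by exact_mod_cast hH (s + c)
    have h3 : s + 1 + c = s + c + 1 := by ring
    have h4 : (s + 1 + (d + 1)).choose (d + 1) = (s + 1 + d).choose d + (s + (d + 1)).choose (d + 1) := by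
      rw [show s + 1 + (d + 1) = (s + 1 + d) + 1 by ring, Nat.choose_succ_succ,
        show s + (d + 1) = s + 1 + d by ring]
    rw [h3] at h1 ⊢
    rw [h4]
    push_cast at h2 ⊢
    linarith

lemma minPrimes_anti {I Q Q' : Ideal (MvPolynomial σ ℂ)} (h : Q ∈ I.minimalPrimes)
    (h' : Q' ∈ I.minimalPrimes) (hle : Q ≤ Q') : Q = Q' :=
  le_antisymm hle (h'.2 h.1 hle)

lemma minPrimes_finite [Finite σ] (I : Ideal (MvPolynomial σ ℂ)) : I.minimalPrimes.Finite :=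
  Ideal.finite_minimalPrimes_of_isNoetherianRing _ I

/-- the combined cut -/
lemma Growth.cutMin [Finite σ] (P : Ideal (MvPolynomial σ ℂ)) (hP : P.IsPrime)
    (f : MvPolynomial σ ℂ) (hf : f ∉ P) (hd : f.totalDegree ≤ 1)
    (T : Finset (Ideal (MvPolynomial σ ℂ)))
    (hT : ∀ Q ∈ T, Q ∈ (P ⊔ Ideal.span {f}).minimalPrimes)
    (δ : Ideal (MvPolynomial σ ℂ) → ℝ) (hg : ∀ Q ∈ T, Growth Q (δ Q) (pdim Q)) (hne : 0 < pdim P) :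
    Growth P (∑ Q ∈ T, δ Q) (pdim P) := by
  obtain ⟨d, hd'⟩ : ∃ d, pdim P = d + 1 := ⟨pdim P - 1, by omega⟩
  rw [hd']
  apply Growth.cut P hP f hf hd
  have h1 : Growth (T.inf id) (∑ Q ∈ T, δ Q) d := by
    apply Growth.inf
    · exact fun Q hQ => (hT Q hQ).1.1
    · exact fun Q hQ Q' hQ' h => minPrimes_anti (hT Q hQ) (hT Q' hQ') h
    · intro Q hQ
      have := krull P hP f hf Q (hT Q hQ)
      have h2 := hg Q hQ
      rwa [show pdim Q = d by omega] at h2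
  refine h1.of_le ?_ le_rfl
  apply Finset.le_inf
  exact fun Q hQ => (hT Q hQ).1.2

lemma growth_one_zero [Finite σ] (P : Ideal (MvPolynomial σ ℂ)) (hP : P.IsPrime) :
    Growth P 1 0 := by
  refine ⟨0, fun s => ?_⟩
  have : hilb P (s + 0) ≠ 0 := by
    intro h
    unfold hilb at h
    rw [Submodule.finrank_eq_zero] at h
    have h1 : (P.restrictScalars ℂ).mkQ 1 ∈ (restrictTotalDegree σ ℂ (s + 0)).map (P.restrictScalars ℂ).mkQ :=
      ⟨1, by simp [mem_restrictTotalDegree], rfl⟩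
    rw [h, Submodule.mem_bot, Submodule.mkQ_apply, Submodule.Quotient.mk_eq_zero] at h1
    exact hP.ne_top ((Ideal.eq_top_iff_one _).2 h1)
  simp
  exact_mod_cast Nat.one_le_iff_ne_zero.2 this

lemma exists_coord [Finite σ] (P : Ideal (MvPolynomial σ ℂ)) (hP : P.IsPrime) (h0 : 0 < pdim P) :
    ∃ (f : MvPolynomial σ ℂ), f ∉ P ∧ f.totalDegree ≤ 1 ∧ P ⊔ Ideal.span {f} ≠ ⊤ := by
  obtain ⟨m, hm, hPm⟩ := Ideal.exists_le_maximal P hP.ne_top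
  obtain ⟨a, ha⟩ := isMaximal_iff_eq_vanishingIdeal_singleton.1 hm
  by_cases h : ∃ i, X i - C (a i) ∉ P
  · obtain ⟨i, hi⟩ := h
    refine ⟨_, hi, ?_, ?_⟩
    · refine (totalDegree_sub _ _).trans ?_
      simp
    · intro h
      have : P ⊔ Ideal.span {X i - C (a i)} ≤ m := by
        refine sup_le hPm ?_
        rw [Ideal.span_singleton_le_iff_mem, ha, mem_vanishingIdeal_singleton_iff]
        simp
      rw [h, top_le_iff] at this
      exact hm.ne_top this
  · push Not at h
    exfalso
    have hE : Ideal.Quotient.mkₐ ℂ P = (Algebra.ofId ℂ _).comp (aeval a) := by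
      refine MvPolynomial.algHom_ext fun i => ?_
      have := h i
      rw [← Ideal.Quotient.eq] at this
      simp only [Ideal.Quotient.mkₐ_eq_mk, AlgHom.comp_apply, aeval_X, this]
      rfl
    have halg : Algebra.IsAlgebraic ℂ (MvPolynomial σ ℂ ⧸ P) := by
      constructor
      intro x
      obtain ⟨y, rfl⟩ := Ideal.Quotient.mkₐ_surjective ℂ P x
      rw [hE]
      exact isAlgebraic_algebraMap (aeval a y)
    unfold pdim at h0
    rw [trdeg_eq_zero] at h0
    simp at h0

lemma growth_one [Finite σ] (n : ℕ) : ∀ (P : Ideal (MvPolynomial σ ℂ)), P.IsPrime → pdim P = n →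
    Growth P 1 n := by
  induction n with
  | zero => exact fun P hP _ => growth_one_zero P hP
  | succ n ih =>
    intro P hP hn
    obtain ⟨f, hf, hd, ht⟩ := exists_coord P hP (by omega)
    obtain ⟨m, hm, hPm⟩ := Ideal.exists_le_maximal _ ht
    obtain ⟨Q, hQ, -⟩ := Ideal.exists_minimalPrimes_le hPm
    have hk := krull P hP f hf Q hQ
    have := Growth.cutMin P hP f hf hd {Q} (by simpa using hQ) (fun _ => 1)
      (by
        intro Q' h'
        rw [Finset.mem_singleton] at h'
        rw [h', show pdim Q = n by omega]
        exact ih Q hQ.1.1 (by omega)) (by omega)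
    simpa [hn] using this
end

section
open MvPolynomial

variable {σ : Type}

/-- `u` is a zero of the ideal -/
def InV (P : Ideal (MvPolynomial σ ℂ)) (u : σ → ℂ) : Prop := ∀ f ∈ P, eval u f = 0

/-- witnessed elements -/
def wset {E : Type} (Wit : (σ → ℂ) → E → Prop) (P : Ideal (MvPolynomial σ ℂ)) : Set E :=
  {e | ∃ u, InV P u ∧ Wit u e}

/-- good constant -/
def GoodC (P : Ideal (MvPolynomial σ ℂ)) (δ : ℝ) : Prop := 0 ≤ δ ∧ Growth P δ (pdim P)

/-- bound at a prime -/
def BoundAt {E : Type} (Wit : (σ → ℂ) → E → Prop) (N κ : ℕ) (P : Ideal (MvPolynomial σ ℂ)) : Prop :=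
  ∃ δ : ℝ, GoodC P δ ∧ ((wset Wit P).ncard : ℝ) ≤ δ * (N : ℝ) ^ pdim P * κ

/-- uniform bound -/
def BoundU {E : Type} (Wit : (σ → ℂ) → E → Prop) (N κ : ℕ) : Prop :=
  ∀ P : Ideal (MvPolynomial σ ℂ), P.IsPrime → BoundAt Wit N κ P

lemma GoodC.zero (P : Ideal (MvPolynomial σ ℂ)) : GoodC P 0 :=
  ⟨le_rfl, 0, fun s => by simp⟩

lemma GoodC.ub (P : Ideal (MvPolynomial σ ℂ)) {ι : Type} [Finite ι] (δ : ι → ℝ)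
    (h : ∀ i, GoodC P (δ i)) : ∃ δ', GoodC P δ' ∧ ∀ i, δ i ≤ δ' := by
  cases isEmpty_or_nonempty ι
  · exact ⟨0, GoodC.zero P, fun i => isEmptyElim i⟩
  · obtain ⟨i, hi⟩ := Finite.exists_max δ
    exact ⟨δ i, h i, hi⟩

lemma GoodC.max {P : Ideal (MvPolynomial σ ℂ)} {a b : ℝ} (ha : GoodC P a) (hb : GoodC P b) :
    GoodC P (max a b) := by
  rcases max_cases a b with h | h <;> rw [h.1] <;> assumption

lemma BoundU.of_inj {E E' : Type} [Finite E'] {Wit : (σ → ℂ) → E → Prop}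
    {Wit' : (σ → ℂ) → E' → Prop} {N κ : ℕ} (h : BoundU Wit' N κ) (g : E → E')
    (hg : Function.Injective g) (hW : ∀ u e, Wit u e → Wit' u (g e)) : BoundU Wit N κ := by
  intro P hP
  obtain ⟨δ, h1, h2⟩ := h P hP
  refine ⟨δ, h1, le_trans ?_ h2⟩
  have : (wset Wit P).ncard ≤ (wset Wit' P).ncard := by
    apply Set.ncard_le_ncard_of_injOn g _ hg.injOn (Set.toFinite _)
    rintro e ⟨u, hu, he⟩
    exact ⟨u, hu, hW u e he⟩
  exact_mod_cast this

lemma BoundU.base [Finite σ] {E : Type} [Subsingleton E] (Wit : (σ → ℂ) → E → Prop) {N : ℕ}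
    (hN : 1 ≤ N) : BoundU Wit N 1 := by
  intro P hP
  refine ⟨1, ⟨zero_le_one, growth_one _ P hP rfl⟩, ?_⟩
  have h1 : (wset Wit P).ncard ≤ 1 := Set.ncard_le_one_of_subsingleton _
  have h2 : (1 : ℝ) ≤ (N : ℝ) ^ pdim P := one_le_pow₀ (by exact_mod_cast hN)
  have h3 : ((wset Wit P).ncard : ℝ) ≤ 1 := by exact_mod_cast h1
  simpa using h3.trans h2

lemma BoundU.free {E F : Type} [Finite E] [Finite F] {Wit : (σ → ℂ) → E → Prop} {N κ : ℕ}
    (h : BoundU Wit N κ) : BoundU (fun u (p : F × E) => Wit u p.2) N (Nat.card F * κ) := by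
  intro P hP
  obtain ⟨δ, h1, h2⟩ := h P hP
  refine ⟨δ, h1, ?_⟩
  have hs : wset (fun u (p : F × E) => Wit u p.2) P = Set.univ ×ˢ wset Wit P := by
    ext ⟨a, b⟩; simp [wset]
  rw [hs, Set.ncard_prod, Set.ncard_univ]
  push_cast
  nlinarith [Nat.cast_nonneg (α := ℝ) (Nat.card F)]

lemma cut_cnt [Finite σ] {E : Type} [Finite E] {Wit : (σ → ℂ) → E → Prop} {N κ : ℕ}
    (P : Ideal (MvPolynomial σ ℂ)) (hP : P.IsPrime)
    (f : MvPolynomial σ ℂ) (hf : f ∉ P) (hd : f.totalDegree ≤ 1)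
    (hB : ∀ Q ∈ (P ⊔ Ideal.span {f}).minimalPrimes, BoundAt Wit N κ Q) :
    ∃ δ : ℝ, GoodC P δ ∧ (N : ℝ) * ((wset (fun u e => eval u f = 0 ∧ Wit u e) P).ncard : ℝ) ≤
      δ * (N : ℝ) ^ pdim P * κ := by
  classical
  set T := (minPrimes_finite (P ⊔ Ideal.span {f})).toFinset with hT
  have hTm : ∀ Q, Q ∈ T ↔ Q ∈ (P ⊔ Ideal.span {f}).minimalPrimes := by simp [hT]
  have hB' : ∀ Q : Ideal (MvPolynomial σ ℂ), ∃ δ : ℝ, Q ∈ T → GoodC Q δ ∧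
      ((wset Wit Q).ncard : ℝ) ≤ δ * (N : ℝ) ^ pdim Q * κ := by
    intro Q
    by_cases hQ : Q ∈ T
    · obtain ⟨δ, h⟩ := hB Q ((hTm Q).1 hQ)
      exact ⟨δ, fun _ => h⟩
    · exact ⟨0, fun h => absurd h hQ⟩
  choose δ hδ using hB'
  have hsub : wset (fun u e => eval u f = 0 ∧ Wit u e) P ⊆ ⋃ Q ∈ T, wset Wit Q := by
    rintro e ⟨u, hu, hfu, he⟩
    have hker : (RingHom.ker (eval u)).IsPrime := RingHom.ker_isPrime _
    have hle : P ⊔ Ideal.span {f} ≤ RingHom.ker (eval u) := by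
      refine sup_le (fun g hg => hu g hg) ?_
      rw [Ideal.span_singleton_le_iff_mem]; exact hfu
    obtain ⟨Q, hQ, hQu⟩ := Ideal.exists_minimalPrimes_le hle
    simp only [Set.mem_iUnion]
    exact ⟨Q, (hTm Q).2 hQ, u, fun g hg => hQu hg, he⟩
  have hcard : (wset (fun u e => eval u f = 0 ∧ Wit u e) P).ncard ≤ ∑ Q ∈ T, (wset Wit Q).ncard :=
    (Set.ncard_le_ncard hsub (Set.toFinite _)).trans (Finset.set_ncard_biUnion_le T _)
  by_cases h0 : pdim P = 0
  · refine ⟨0, GoodC.zero P, ?_⟩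
    have hTe : T = ∅ := by
      rw [Finset.eq_empty_iff_forall_notMem]
      intro Q hQ
      have := krull P hP f hf Q ((hTm Q).1 hQ)
      omega
    rw [hTe] at hcard
    simp only [Finset.sum_empty, Nat.le_zero] at hcard
    simp [hcard]
  · refine ⟨∑ Q ∈ T, δ Q, ⟨Finset.sum_nonneg fun Q hQ => (hδ Q hQ).1.1, ?_⟩, ?_⟩
    · exact Growth.cutMin P hP f hf hd T (fun Q hQ => (hTm Q).1 hQ) δ
        (fun Q hQ => (hδ Q hQ).1.2) (Nat.pos_of_ne_zero h0)
    · have h1 : ((wset (fun u e => eval u f = 0 ∧ Wit u e) P).ncard : ℝ) ≤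
          ∑ Q ∈ T, ((wset Wit Q).ncard : ℝ) := by exact_mod_cast hcard
      calc (N : ℝ) * ((wset (fun u e => eval u f = 0 ∧ Wit u e) P).ncard : ℝ)
          ≤ N * ∑ Q ∈ T, ((wset Wit Q).ncard : ℝ) := by gcongr
        _ = ∑ Q ∈ T, N * ((wset Wit Q).ncard : ℝ) := Finset.mul_sum _ _ _
        _ ≤ ∑ Q ∈ T, δ Q * (N : ℝ) ^ pdim P * κ := by
            apply Finset.sum_le_sum
            intro Q hQ
            have h2 := (hδ Q hQ).2
            have h3 := krull P hP f hf Q ((hTm Q).1 hQ)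
            rw [← h3, pow_succ]
            calc (N : ℝ) * ((wset Wit Q).ncard : ℝ) ≤ N * (δ Q * (N : ℝ) ^ pdim Q * κ) := by gcongr
              _ = _ := by ring
        _ = _ := by rw [Finset.sum_mul, Finset.sum_mul]

lemma BoundU.step [Finite σ] {E Y : Type} [Finite E] [Fintype Y] [Nonempty Y]
    {Wit : (σ → ℂ) → Y × E → Prop} {WR : (σ → ℂ) → E → Prop} {WN : Y → (σ → ℂ) → E → Prop}
    {κR κN k : ℕ} (l : Y → MvPolynomial σ ℂ) (hl : ∀ y, (l y).totalDegree ≤ 1)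
    (h0 : ∀ u y e, Wit u (y, e) → eval u (l y) = 0 → WR u e)
    (h1 : ∀ u y e, Wit u (y, e) → eval u (l y) ≠ 0 → WN y u e)
    (hk : ∀ u y e, Wit u (y, e) → {y | eval u (l y) = 0}.ncard ≤ k)
    (hR : BoundU WR (Fintype.card Y) κR) (hN : ∀ y, BoundU (WN y) (Fintype.card Y) κN) :
    BoundU Wit (Fintype.card Y) (k * κR + Fintype.card Y * κN) := by
  classical
  intro P hP
  set N := Fintype.card Y with hNdef
  have hNpos : 0 < N := Fintype.card_pos
  have hNR : (0 : ℝ) < N := by exact_mod_cast hNpos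
  by_cases hne : (wset Wit P) = ∅
  · refine ⟨0, GoodC.zero P, ?_⟩
    simp [hne]
  obtain ⟨⟨y0, e0⟩, u0, hu0, hw0⟩ := Set.nonempty_iff_ne_empty.2 hne
  obtain ⟨δR, gR, bR⟩ := hR P hP
  choose δN gN bN using fun y => hN y P hP
  have hcut : ∀ y, ∃ δ : ℝ, GoodC P δ ∧ (l y ∉ P → (N : ℝ) *
      ((wset (fun u e => eval u (l y) = 0 ∧ WR u e) P).ncard : ℝ) ≤ δ * (N : ℝ) ^ pdim P * κR) := by
    intro y
    by_cases hy : l y ∈ P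
    · exact ⟨0, GoodC.zero P, fun h => absurd hy h⟩
    · obtain ⟨δ, h, h'⟩ := cut_cnt P hP (l y) hy (hl y) (fun Q hQ => hR Q hQ.1.1)
      exact ⟨δ, h, fun _ => h'⟩
  choose δC gC bC using hcut
  obtain ⟨δ1, g1, ub1⟩ := GoodC.ub P δN gN
  obtain ⟨δ2, g2, ub2⟩ := GoodC.ub P δC gC
  set δ := max δR (max δ1 δ2) with hδ
  have gδ : GoodC P δ := gR.max (g1.max g2)
  have leR : δR ≤ δ := le_max_left _ _
  have leN : ∀ y, δN y ≤ δ := fun y => (ub1 y).trans ((le_max_left _ _).trans (le_max_right _ _))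
  have leC : ∀ y, δC y ≤ δ := fun y => (ub2 y).trans ((le_max_right _ _).trans (le_max_right _ _))
  refine ⟨δ, gδ, ?_⟩
  set Θ : Finset Y := Finset.univ.filter (fun y => l y ∈ P) with hΘ
  have hΘsub : ∀ u, InV P u → (Θ : Set Y) ⊆ {y | eval u (l y) = 0} := by
    intro u hu y hy
    simp only [hΘ, Finset.coe_filter, Finset.mem_univ, true_and, Set.mem_ofPred_eq] at hy
    exact hu _ hy
  have hΘk : Θ.card ≤ k := by
    have := Set.ncard_le_ncard (hΘsub u0 hu0) (Set.toFinite _)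
    rw [Set.ncard_coe_finset] at this
    exact this.trans (hk u0 y0 e0 hw0)
  let A : Y → Set E := fun y => {e | ∃ u, InV P u ∧ Wit u (y, e)}
  let ε : ℝ := if Θ.card < k then 1 else 0
  set X : ℝ := δ * (N : ℝ) ^ pdim P with hX
  have hX0 : 0 ≤ X := mul_nonneg gδ.1 (by positivity)
  have hA : ∀ y, ((A y).ncard : ℝ) ≤ X * (if l y ∈ P then (κR : ℝ) else ε * κR / N + κN) := by
    intro y
    by_cases hy : l y ∈ P
    · rw [if_pos hy]
      have hs : A y ⊆ wset WR P := by
        rintro e ⟨u, hu, he⟩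
        exact ⟨u, hu, h0 u y e he (hu _ hy)⟩
      have h2 : ((A y).ncard : ℝ) ≤ (wset WR P).ncard := by
        exact_mod_cast Set.ncard_le_ncard hs (Set.toFinite _)
      refine h2.trans (bR.trans ?_)
      rw [hX]; gcongr
    · rw [if_neg hy]
      have hbN : ((wset (WN y) P).ncard : ℝ) ≤ X * κN := by
        refine (bN y).trans ?_
        rw [hX]; gcongr; exact leN y
      by_cases hθ : Θ.card < k
      · have hs : A y ⊆ wset (fun u e => eval u (l y) = 0 ∧ WR u e) P ∪ wset (WN y) P := by
          rintro e ⟨u, hu, he⟩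
          by_cases h : eval u (l y) = 0
          · exact Or.inl ⟨u, hu, h, h0 u y e he h⟩
          · exact Or.inr ⟨u, hu, h1 u y e he h⟩
        have h2 : ((A y).ncard : ℝ) ≤ (wset (fun u e => eval u (l y) = 0 ∧ WR u e) P).ncard +
            (wset (WN y) P).ncard := by
          exact_mod_cast (Set.ncard_le_ncard hs (Set.toFinite _)).trans (Set.ncard_union_le _ _)
        have h3 : ((wset (fun u e => eval u (l y) = 0 ∧ WR u e) P).ncard : ℝ) ≤ X * (κR / N) := by
          rw [← mul_div_assoc, le_div_iff₀ hNR, mul_comm]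
          refine (bC y hy).trans ?_
          rw [hX]; gcongr; exact leC y
        simp only [ε, if_pos hθ, one_mul, mul_add]
        linarith
      · have hs : A y ⊆ wset (WN y) P := by
          rintro e ⟨u, hu, he⟩
          refine ⟨u, hu, h1 u y e he fun h => ?_⟩
          have h2 : insert y Θ ⊆ (Set.toFinite {y | eval u (l y) = 0}).toFinset := by
            intro z hz
            rw [Finset.mem_insert] at hz
            rw [Set.Finite.mem_toFinset]
            rcases hz with rfl | hz
            · exact h
            · exact hΘsub u hu hz
          have h3 := Finset.card_le_card h2
          rw [← Set.ncard_eq_toFinset_card, Finset.card_insert_of_notMem (by simp [hΘ, hy])] at h3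
          have := hk u y e he
          omega
        have h2 : ((A y).ncard : ℝ) ≤ (wset (WN y) P).ncard := by
          exact_mod_cast Set.ncard_le_ncard hs (Set.toFinite _)
        simp only [ε, if_neg hθ, zero_mul, zero_div, zero_add]
        linarith
  have hsum : (wset Wit P).ncard ≤ ∑ y, (A y).ncard := by
    have hs : wset Wit P ⊆ ⋃ y ∈ (Finset.univ : Finset Y), (Prod.mk y) '' (A y) := by
      rintro ⟨y, e⟩ ⟨u, hu, he⟩
      simp only [Set.mem_iUnion]
      exact ⟨y, Finset.mem_univ _, e, ⟨u, hu, he⟩, rfl⟩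
    refine (Set.ncard_le_ncard hs (Set.toFinite _)).trans
      ((Finset.set_ncard_biUnion_le _ _).trans ?_)
    apply Finset.sum_le_sum
    intro y _
    exact Set.ncard_image_le (Set.toFinite _)
  have hw : ∑ y, (if l y ∈ P then (κR : ℝ) else ε * κR / N + κN) ≤ k * κR + N * κN := by
    rw [Finset.sum_ite, Finset.sum_const, Finset.sum_const, nsmul_eq_mul, nsmul_eq_mul]
    have hc : ((Finset.univ.filter (fun y => ¬ l y ∈ P)).card : ℝ) ≤ N := by
      exact_mod_cast Finset.card_le_univ _
    have hε : 0 ≤ ε := by simp only [ε]; split_ifs <;> norm_num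
    have hθε : (Θ.card : ℝ) + ε ≤ k := by
      simp only [ε]; split_ifs with h
      · exact_mod_cast h
      · simpa using hΘk
    have hκ : (0 : ℝ) ≤ ε * κR / N + κN := by positivity
    calc (Θ.card : ℝ) * κR + ((Finset.univ.filter (fun y => ¬ l y ∈ P)).card : ℝ) * (ε * κR / N + κN)
        ≤ (Θ.card : ℝ) * κR + N * (ε * κR / N + κN) := by gcongr
      _ = ((Θ.card : ℝ) + ε) * κR + N * κN := by field_simp; ring
      _ ≤ k * κR + N * κN := by gcongr
  have h3 : ((wset Wit P).ncard : ℝ) ≤ ∑ y, ((A y).ncard : ℝ) := by exact_mod_cast hsum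
  calc ((wset Wit P).ncard : ℝ) ≤ ∑ y, ((A y).ncard : ℝ) := h3
    _ ≤ ∑ y, X * (if l y ∈ P then (κR : ℝ) else ε * κR / N + κN) :=
        Finset.sum_le_sum fun y _ => hA y
    _ = X * ∑ y, (if l y ∈ P then (κR : ℝ) else ε * κR / N + κN) := (Finset.mul_sum _ _ _).symm
    _ ≤ X * (k * κR + N * κN) := by gcongr
    _ = _ := by push_cast; ring
end

section
open MvPolynomial

variable {σ : Type}

/-- rank of an exponent vector -/
def erank {D : ℕ} : {r : ℕ} → (Fin r → Fin (D + 1)) → ℕ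
  | 0, _ => 0
  | _ + 1, α => (α 0 : ℕ) + (D + 1) * erank (Fin.tail α)

lemma erank_cons {D r : ℕ} (b : Fin (D + 1)) (α : Fin r → Fin (D + 1)) :
    erank (Fin.cons b α : Fin (r + 1) → Fin (D + 1)) = (b : ℕ) + (D + 1) * erank α := by
  simp [erank]

/-- value of family at a point -/
noncomputable def fval {D r : ℕ} {Y : Type} (v : Y → ℂ)
    (a : (Fin r → Fin (D + 1)) → MvPolynomial σ ℂ) (u : σ → ℂ) (y : Fin r → Y) : ℂ :=
  ∑ α : Fin r → Fin (D + 1), eval u (a α) * ∏ i, v (y i) ^ (α i : ℕ)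

/-- leading condition -/
def isLead {D r : ℕ} (a : (Fin r → Fin (D + 1)) → MvPolynomial σ ℂ) (β : Fin r → Fin (D + 1))
    (u : σ → ℂ) : Prop :=
  (∀ α, erank β < erank α → eval u (a α) = 0) ∧ eval u (a β) ≠ 0

/-- restricted family -/
noncomputable def restr {D r : ℕ} (a : (Fin (r + 1) → Fin (D + 1)) → MvPolynomial σ ℂ) (z : ℂ)
    (α : Fin r → Fin (D + 1)) : MvPolynomial σ ℂ :=
  ∑ b : Fin (D + 1), C (z ^ (b : ℕ)) * a (Fin.cons b α)

lemma restr_deg {D r : ℕ} (a : (Fin (r + 1) → Fin (D + 1)) → MvPolynomial σ ℂ) (z : ℂ)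
    (ha : ∀ α, (a α).totalDegree ≤ 1) (α : Fin r → Fin (D + 1)) :
    (restr a z α).totalDegree ≤ 1 := by
  apply totalDegree_finsetSum_le
  intro b _
  refine (totalDegree_mul _ _).trans ?_
  rw [totalDegree_C, zero_add]
  exact ha _

lemma eval_restr {D r : ℕ} (a : (Fin (r + 1) → Fin (D + 1)) → MvPolynomial σ ℂ) (z : ℂ)
    (α : Fin r → Fin (D + 1)) (u : σ → ℂ) :
    eval u (restr a z α) = ∑ b : Fin (D + 1), z ^ (b : ℕ) * eval u (a (Fin.cons b α)) := by
  simp [restr]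

lemma fval_restr {D r : ℕ} {Y : Type} (v : Y → ℂ)
    (a : (Fin (r + 1) → Fin (D + 1)) → MvPolynomial σ ℂ) (u : σ → ℂ) (y : Fin (r + 1) → Y) :
    fval v a u y = fval v (restr a (v (y 0))) u (Fin.tail y) := by
  unfold fval
  rw [← (Fin.consEquiv (fun _ => Fin (D + 1))).sum_comp, Fintype.sum_prod_type, Finset.sum_comm]
  apply Finset.sum_congr rfl
  intro α _
  rw [eval_restr, Finset.sum_mul]
  apply Finset.sum_congr rfl
  intro b _
  have hc : Fin.consEquiv (fun _ => Fin (D + 1)) (b, α) = Fin.cons b α := rfl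
  rw [hc]
  simp only [Fin.prod_univ_succ, Fin.cons_zero, Fin.cons_succ, Fin.tail]
  ring

lemma erank_lt_cons {D r : ℕ} (β : Fin (r + 1) → Fin (D + 1)) (α : Fin r → Fin (D + 1))
    (b : Fin (D + 1)) (h : erank (Fin.tail β) < erank α) :
    erank β < erank (Fin.cons b α : Fin (r + 1) → Fin (D + 1)) := by
  rw [erank_cons]
  show (β 0 : ℕ) + (D + 1) * erank (Fin.tail β) < _
  have h1 := (β 0).2
  have h2 : (D + 1) * (erank (Fin.tail β) + 1) ≤ (D + 1) * erank α := Nat.mul_le_mul_left _ h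
  rw [mul_add] at h2
  omega

lemma root_count {D : ℕ} {Y : Type} [Finite Y] (v : Y → ℂ) (hv : Function.Injective v)
    (c : Fin (D + 1) → ℂ) (b : Fin (D + 1)) (hb : c b ≠ 0) (hc : ∀ k, b < k → c k = 0) :
    {y | ∑ k : Fin (D + 1), v y ^ (k : ℕ) * c k = 0}.ncard ≤ b := by
  classical
  let p : Polynomial ℂ := ∑ k : Fin (D + 1), Polynomial.monomial (k : ℕ) (c k)
  have hcoef : p.coeff b = c b := by
    simp only [p, Polynomial.finsetSum_coeff, Polynomial.coeff_monomial]
    rw [Finset.sum_eq_single b]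
    · simp
    · intro k _ hk
      rw [if_neg]
      intro h; exact hk (Fin.ext h)
    · simp
  have hp0 : p ≠ 0 := by
    intro h; rw [h] at hcoef; exact hb (by simpa using hcoef.symm)
  have hdeg : p.natDegree ≤ b := by
    apply Polynomial.natDegree_sum_le_of_forall_le
    intro k _
    by_cases hk : b < k
    · rw [hc k hk]; simp
    · exact (Polynomial.natDegree_monomial_le _).trans (Fin.not_lt.1 hk)
  have hsub : v '' {y | ∑ k : Fin (D + 1), v y ^ (k : ℕ) * c k = 0} ⊆ (p.roots.toFinset : Set ℂ) := by
    rintro _ ⟨y, hy, rfl⟩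
    simp only [Finset.mem_coe, Multiset.mem_toFinset, Polynomial.mem_roots hp0, Polynomial.IsRoot.def]
    simp only [Set.mem_ofPred_eq] at hy
    rw [← hy]
    simp only [p, Polynomial.eval_finsetSum, Polynomial.eval_monomial]
    exact Finset.sum_congr rfl fun k _ => mul_comm _ _
  have h1 := Set.ncard_le_ncard hsub (Set.toFinite _)
  rw [Set.ncard_image_of_injective _ hv, Set.ncard_coe_finset] at h1
  exact h1.trans ((Multiset.toFinset_card_le _).trans ((Polynomial.card_roots' p).trans hdeg))

lemma inner_bound [Finite σ] {D : ℕ} {Y : Type} [Fintype Y] [Nonempty Y] (v : Y → ℂ)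
    (hv : Function.Injective v) {E : Type} [Finite E] {WR : (σ → ℂ) → E → Prop} {κ : ℕ}
    (hR : BoundU WR (Fintype.card Y) κ) (r : ℕ) :
    ∀ (a : (Fin r → Fin (D + 1)) → MvPolynomial σ ℂ) (_ : ∀ α, (a α).totalDegree ≤ 1)
      (β : Fin r → Fin (D + 1)),
      BoundU (fun u (p : (Fin r → Y) × E) => isLead a β u ∧ fval v a u p.1 = 0 ∧ WR u p.2)
        (Fintype.card Y) ((∑ i, (β i : ℕ)) * Fintype.card Y ^ (r - 1) * κ) := by
  induction r with
  | zero =>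
    intro a ha β P hP
    refine ⟨0, GoodC.zero P, ?_⟩
    have : wset (fun u (p : (Fin 0 → Y) × E) => isLead a β u ∧ fval v a u p.1 = 0 ∧ WR u p.2) P = ∅ := by
      rw [Set.eq_empty_iff_forall_notMem]
      rintro e ⟨u, hu, hl, hf, -⟩
      apply hl.2
      have h2 : fval v a u e.1 = eval u (a β) := by
        unfold fval
        rw [Fintype.sum_subsingleton _ β]
        simp
      rw [← h2]
      exact hf
    simp [this]
  | succ r ih =>
    intro a ha β
    set N := Fintype.card Y with hN
    have hfree : BoundU (fun u (p : (Fin r → Y) × E) => WR u p.2) N (N ^ r * κ) := by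
      have := BoundU.free (F := Fin r → Y) hR
      simpa using this
    have hst := BoundU.step (Y := Y) (E := (Fin r → Y) × E)
      (Wit := fun u (p : Y × ((Fin r → Y) × E)) => isLead a β u ∧
        fval v a u (Fin.cons p.1 p.2.1) = 0 ∧ WR u p.2.2)
      (WR := fun u (p : (Fin r → Y) × E) => WR u p.2)
      (WN := fun y u (p : (Fin r → Y) × E) => isLead (restr a (v y)) (Fin.tail β) u ∧
        fval v (restr a (v y)) u p.1 = 0 ∧ WR u p.2)
      (k := (β 0 : ℕ))
      (fun y => restr a (v y) (Fin.tail β)) (fun y => restr_deg a _ ha _)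
      (fun u y e h _ => h.2.2)
      (by
        intro u y e h hne
        refine ⟨⟨?_, hne⟩, ?_, h.2.2⟩
        · intro α hα
          rw [eval_restr]
          apply Finset.sum_eq_zero
          intro b _
          rw [h.1.1 _ (erank_lt_cons β α b hα), mul_zero]
        · have := h.2.1
          rw [fval_restr] at this
          simpa using this)
      (by
        intro u y e h
        simp only [eval_restr]
        apply root_count v hv (fun b => eval u (a (Fin.cons b (Fin.tail β)))) (β 0)
        · have := h.1.2
          rwa [← Fin.cons_self_tail β] at this
        · intro k hk
          apply h.1.1
          rw [erank_cons]
          show (β 0 : ℕ) + (D + 1) * erank (Fin.tail β) < _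
          have : (β 0 : ℕ) < k := hk
          omega)
      hfree (fun y => ih (restr a (v y)) (restr_deg a _ ha) (Fin.tail β))
    have hκ : (β 0 : ℕ) * (N ^ r * κ) + N * ((∑ i, (Fin.tail β i : ℕ)) * N ^ (r - 1) * κ) =
        (∑ i, (β i : ℕ)) * N ^ (r + 1 - 1) * κ := by
      rw [Fin.sum_univ_succ]
      rcases r with _ | r
      · simp
      · simp only [Nat.add_sub_cancel, Fin.tail]; ring
    rw [← hN, hκ] at hst
    refine hst.of_inj (fun p => (p.1 0, (Fin.tail p.1, p.2))) ?_ ?_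
    · rintro ⟨y, e⟩ ⟨y', e'⟩ h
      simp only [Prod.mk.injEq] at h
      obtain ⟨h1, h2, h3⟩ := h
      rw [← Fin.cons_self_tail y, ← Fin.cons_self_tail y', h1, h2, h3]
    · rintro u ⟨y, e⟩ h
      simpa using h

lemma outer_bound [Finite σ] {D t : ℕ} {Y : Type} [Fintype Y] [Nonempty Y] (v : Y → ℂ)
    (hv : Function.Injective v) (a : (Fin t → Fin (D + 1)) → MvPolynomial σ ℂ)
    (ha : ∀ α, (a α).totalDegree ≤ 1) (β : Fin t → Fin (D + 1)) (m : ℕ) :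
    BoundU (fun u (γ : Fin m → Fin t → Y) => isLead a β u ∧ ∀ i, fval v a u (γ i) = 0)
      (Fintype.card Y) (((∑ i, (β i : ℕ)) * Fintype.card Y ^ (t - 1)) ^ m) := by
  induction m with
  | zero =>
    rw [pow_zero]
    exact BoundU.base _ Fintype.card_pos
  | succ m ih =>
    have := inner_bound v hv ih t a ha β
    rw [pow_succ', ]
    refine this.of_inj (fun γ => (γ 0, Fin.tail γ)) ?_ ?_
    · intro y y' h
      simp only [Prod.mk.injEq] at h
      rw [← Fin.cons_self_tail y, ← Fin.cons_self_tail y', h.1, h.2]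
    · rintro u γ ⟨h1, h2⟩
      exact ⟨h1, h2 0, h1, fun i => h2 i.succ⟩

lemma BoundAt.mono {E : Type} {Wit : (σ → ℂ) → E → Prop} {N κ κ' : ℕ}
    {P : Ideal (MvPolynomial σ ℂ)} (h : BoundAt Wit N κ P) (hk : κ ≤ κ') : BoundAt Wit N κ' P := by
  obtain ⟨δ, h1, h2⟩ := h
  refine ⟨δ, h1, h2.trans ?_⟩
  have := h1.1
  gcongr

lemma strata_bound [Finite σ] {D t : ℕ} {Y : Type} [Fintype Y] (hY : 2 ≤ Fintype.card Y) (v : Y → ℂ)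
    (hv : Function.Injective v) (a : (Fin t → Fin (D + 1)) → MvPolynomial σ ℂ)
    (ha : ∀ α, (a α).totalDegree ≤ 1) (hs : ∀ α, D < ∑ i, (α i : ℕ) → a α = 0) (m : ℕ) (n : ℕ) :
    ∀ P : Ideal (MvPolynomial σ ℂ), P.IsPrime → pdim P = n →
    BoundAt (fun u (γ : Fin m → Fin t → Y) => (∃ α, eval u (a α) ≠ 0) ∧ ∀ i, fval v a u (γ i) = 0)
      (Fintype.card Y) (2 * (D * Fintype.card Y ^ (t - 1)) ^ m) P := by
  classical
  have : Nonempty Y := Fintype.card_pos_iff.1 (by omega)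
  induction n with
  | zero => ?_
  | succ n ih => ?_
  all_goals
    intro P hP hd
    by_cases hall : ∀ α, a α ∈ P
    · refine ⟨0, GoodC.zero P, ?_⟩
      have : wset (fun u (γ : Fin m → Fin t → Y) =>
          (∃ α, eval u (a α) ≠ 0) ∧ ∀ i, fval v a u (γ i) = 0) P = ∅ := by
        rw [Set.eq_empty_iff_forall_notMem]
        rintro e ⟨u, hu, ⟨α, hα⟩, -⟩
        exact hα (hu _ (hall α))
      simp [this]
    push Not at hall
    obtain ⟨α0, h0⟩ := hall
    obtain ⟨β, hβ, hmax⟩ := Finset.exists_max_image (Finset.univ.filter fun α => a α ∉ P) erank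
      ⟨α0, by simpa using h0⟩
    simp only [Finset.mem_filter, Finset.mem_univ, true_and] at hβ hmax
    have hβD : ∑ i, (β i : ℕ) ≤ D := by
      by_contra hlt
      apply hβ
      rw [hs β (by omega)]
      exact zero_mem _
    set N := Fintype.card Y with hN
    set κ := (D * N ^ (t - 1)) ^ m with hκ
    obtain ⟨δ1, g1, b1⟩ := (outer_bound v hv a ha β m P hP).mono
      (κ' := κ) (by rw [hκ]; gcongr)
    obtain ⟨δ2, g2, b2⟩ := cut_cnt (N := N) (κ := 2 * κ) (Wit := fun u (γ : Fin m → Fin t → Y) =>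
      (∃ α, eval u (a α) ≠ 0) ∧ ∀ i, fval v a u (γ i) = 0) P hP (a β) hβ (ha β)
      (by
        intro Q hQ
        have hk := krull P hP (a β) hβ Q hQ
        first
          | exact ih Q hQ.1.1 (by omega)
          | (exfalso; omega))
    have hsub : wset (fun u (γ : Fin m → Fin t → Y) =>
          (∃ α, eval u (a α) ≠ 0) ∧ ∀ i, fval v a u (γ i) = 0) P ⊆
        wset (fun u (γ : Fin m → Fin t → Y) => isLead a β u ∧ ∀ i, fval v a u (γ i) = 0) P ∪
        wset (fun u (γ : Fin m → Fin t → Y) => eval u (a β) = 0 ∧ (∃ α, eval u (a α) ≠ 0) ∧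
          ∀ i, fval v a u (γ i) = 0) P := by
      rintro γ ⟨u, hu, hne, hz⟩
      by_cases hb : eval u (a β) = 0
      · exact Or.inr ⟨u, hu, hb, hne, hz⟩
      · refine Or.inl ⟨u, hu, ⟨?_, hb⟩, hz⟩
        intro α hα
        by_contra hα0
        have : a α ∉ P := fun h => hα0 (hu _ h)
        have := hmax α this
        omega
    have hc : ((wset (fun u (γ : Fin m → Fin t → Y) =>
          (∃ α, eval u (a α) ≠ 0) ∧ ∀ i, fval v a u (γ i) = 0) P).ncard : ℝ) ≤
        (wset (fun u (γ : Fin m → Fin t → Y) => isLead a β u ∧ ∀ i, fval v a u (γ i) = 0) P).ncard +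
        (wset (fun u (γ : Fin m → Fin t → Y) => eval u (a β) = 0 ∧ (∃ α, eval u (a α) ≠ 0) ∧
          ∀ i, fval v a u (γ i) = 0) P).ncard := by
      exact_mod_cast (Set.ncard_le_ncard hsub (Set.toFinite _)).trans (Set.ncard_union_le _ _)
    refine ⟨max δ1 δ2, g1.max g2, hc.trans ?_⟩
    have hN2 : (2 : ℝ) ≤ N := by exact_mod_cast hY
    have e1 : δ1 * (N : ℝ) ^ pdim P * κ ≤ max δ1 δ2 * (N : ℝ) ^ pdim P * κ := by
      gcongr; exact le_max_left _ _
    have e2 : δ2 * (N : ℝ) ^ pdim P * κ ≤ max δ1 δ2 * (N : ℝ) ^ pdim P * κ := by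
      gcongr; exact le_max_right _ _
    push_cast at b2 ⊢
    have hnn := Nat.cast_nonneg (α := ℝ) (wset (fun u (γ : Fin m → Fin t → Y) => eval u (a β) = 0 ∧ (∃ α, eval u (a α) ≠ 0) ∧
          ∀ i, fval v a u (γ i) = 0) P).ncard
    nlinarith
end

section
open MvPolynomial

lemma card_deg_le {τ : Type} [Fintype τ] (m : ℕ) :
    {x : τ →₀ ℕ | x.degree ≤ m}.ncard ≤ (m + Fintype.card τ).choose (Fintype.card τ) := by
  classical
  have hsub : {x : τ →₀ ℕ | x.degree ≤ m} ⊆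
      (((Finset.finsuppAntidiag (Finset.univ : Finset (Option τ)) m).image Finsupp.some : Finset _) :
        Set (τ →₀ ℕ)) := by
    intro x hx
    simp only [Set.mem_ofPred_eq] at hx
    rw [Finset.mem_coe, Finset.mem_image]
    refine ⟨Finsupp.equivFunOnFinite.symm (fun o => o.elim (m - x.degree) x), ?_, ?_⟩
    · rw [Finset.mem_finsuppAntidiag]
      refine ⟨?_, Finset.subset_univ _⟩
      rw [Fintype.sum_option]
      simp only [Finsupp.equivFunOnFinite_symm_apply_apply, Option.elim]
      rw [← Finsupp.degree_eq_sum]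
      omega
    · ext i
      simp
  refine (Set.ncard_le_ncard hsub (Finset.finite_toSet _)).trans ?_
  rw [Set.ncard_coe_finset]
  refine Finset.card_image_le.trans ?_
  have : Nonempty (Option τ) := ⟨none⟩
  rw [Finset.card_finsuppAntidiag_nat_eq_choose]
  simp
  rw [add_comm, Nat.choose_symm_add]

lemma finrank_restrict_le {τ : Type} [Fintype τ] (m : ℕ) :
    Module.finrank ℂ (restrictTotalDegree τ ℂ m) ≤
      (m + Fintype.card τ).choose (Fintype.card τ) := by
  refine le_trans (le_of_eq ?_) (card_deg_le m)
  rw [restrictTotalDegree, Module.finrank_eq_nat_card_basis (basisRestrictSupport ℂ _)]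
  rfl

lemma le_of_choose_growth (δ : ℝ) (hδ : 0 ≤ δ) (n c d : ℕ)
    (h : ∀ s : ℕ, δ * ((s + n).choose n : ℝ) ≤ (((s + c) * d + n).choose n : ℝ)) :
    δ ≤ (d : ℝ) ^ n := by
  have h1 : ∀ s : ℕ, δ ≤ ((d : ℝ) + ((c : ℝ) * d + n - d) * (1 / ((s : ℝ) + 1))) ^ n := by
    intro s
    have a1 : (s + 1) ^ n ≤ n.factorial * (s + n).choose n := by
      rw [← Nat.ascFactorial_eq_factorial_mul_choose]
      exact Nat.pow_succ_le_ascFactorial (s + 1) n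
    have a2 : n.factorial * ((s + c) * d + n).choose n ≤ ((s + c) * d + n) ^ n := by
      rw [← Nat.ascFactorial_eq_factorial_mul_choose]
      exact Nat.ascFactorial_le_pow_add _ _
    have a1' : ((s : ℝ) + 1) ^ n ≤ n.factorial * ((s + n).choose n : ℝ) := by exact_mod_cast a1
    have a2' : (n.factorial : ℝ) * (((s + c) * d + n).choose n : ℝ) ≤ (((s : ℝ) + c) * d + n) ^ n := by
      exact_mod_cast a2
    have a3 : δ * ((s : ℝ) + 1) ^ n ≤ (((s : ℝ) + c) * d + n) ^ n := by
      calc δ * ((s : ℝ) + 1) ^ n ≤ δ * (n.factorial * ((s + n).choose n : ℝ)) := by gcongr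
        _ = n.factorial * (δ * ((s + n).choose n : ℝ)) := by ring
        _ ≤ n.factorial * (((s + c) * d + n).choose n : ℝ) := by gcongr; exact h s
        _ ≤ _ := a2'
    have hs : (0 : ℝ) < (s : ℝ) + 1 := by positivity
    rw [← le_div_iff₀ (by positivity), ← div_pow] at a3
    have e : (d : ℝ) + ((c : ℝ) * d + n - d) * (1 / ((s : ℝ) + 1)) =
        (((s : ℝ) + c) * d + n) / ((s : ℝ) + 1) := by
      field_simp
      ring
    rw [e]
    exact a3
  have h2 := tendsto_one_div_add_atTop_nhds_zero_nat (𝕜 := ℝ)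
  have h3 := ((h2.const_mul ((c : ℝ) * d + n - d)).const_add (d : ℝ)).pow n
  simp only [mul_zero, add_zero] at h3
  exact ge_of_tendsto' h3 h1

lemma exists_tb {B : Type} [CommRing B] [IsDomain B] [Algebra ℂ B] (R₀ : Subalgebra ℂ B) (T : Set B)
    (hT : Algebra.adjoin ℂ T = ⊤) : ∃ J ⊆ T, AlgebraicIndependent R₀ ((↑) : J → B) ∧
      Algebra.IsAlgebraic (R₀ ⊔ Algebra.adjoin ℂ J : Subalgebra ℂ B) B := by
  have halg : Algebra.IsAlgebraic (Algebra.adjoin R₀ T) B := by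
    have htop : Algebra.adjoin R₀ T = ⊤ := by
      rw [eq_top_iff]
      intro x _
      have : x ∈ Algebra.adjoin ℂ T := by
        rw [hT]; trivial
      have h2 : Algebra.adjoin ℂ T ≤ (Algebra.adjoin R₀ T).restrictScalars ℂ :=
        Algebra.adjoin_le (fun y hy => (Algebra.subset_adjoin (R := R₀) hy : y ∈ Algebra.adjoin R₀ _))
      exact h2 this
    rw [htop]
    constructor
    intro x
    exact isAlgebraic_algebraMap (⟨x, trivial⟩ : (⊤ : Subalgebra R₀ B))
  obtain ⟨J, hJ, hb⟩ := exists_isTranscendenceBasis_subset (R := R₀) T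
  refine ⟨J, hJ, hb.1, ?_⟩
  have h1 := hb.isAlgebraic
  rw [Subtype.range_coe] at h1
  have h2 : Algebra.IsAlgebraic ((Algebra.adjoin R₀ J).restrictScalars ℂ) B := h1
  have h3 : (Algebra.adjoin R₀ J).restrictScalars ℂ = R₀ ⊔ Algebra.adjoin ℂ J := by
    apply le_antisymm
    · intro x hx
      have hx' : x ∈ Algebra.adjoin R₀ J := hx
      induction hx' using Algebra.adjoin_induction with
      | mem y hy => exact (le_sup_right : _ ≤ R₀ ⊔ Algebra.adjoin ℂ J) (Algebra.subset_adjoin hy)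
      | algebraMap r => exact (le_sup_left : _ ≤ R₀ ⊔ Algebra.adjoin ℂ J) r.2
      | add y z hy hz h1 h2 => exact add_mem (h1 hy) (h2 hz)
      | mul y z hy hz h1 h2 => exact mul_mem (h1 hy) (h2 hz)
    · apply sup_le
      · intro x hx
        exact (Algebra.adjoin R₀ J).algebraMap_mem (⟨x, hx⟩ : R₀)
      · exact Algebra.adjoin_le (fun y hy => (Algebra.subset_adjoin (R := R₀) hy : y ∈ Algebra.adjoin R₀ _))
  rw [h3] at h2
  exact h2

lemma trdeg_sub_eq {B : Type} [CommRing B] [IsDomain B] [Algebra ℂ B] (S : Subalgebra ℂ B)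
    [Algebra.IsAlgebraic S B] : Algebra.trdeg ℂ S = Algebra.trdeg ℂ B := by
  have hf : FaithfulSMul ℂ S :=
    (faithfulSMul_iff_algebraMap_injective ℂ S).2 (RingHom.injective (algebraMap ℂ S))
  have h1 := trdeg_add_eq ℂ S (A := B)
  rw [trdeg_eq_zero (R := S) (A := B), add_zero] at h1
  exact h1

lemma totalDegree_aeval_le' {σ τ : Type} (f : σ → MvPolynomial τ ℂ) (d : ℕ)
    (hf : ∀ i, (f i).totalDegree ≤ d) (p : MvPolynomial σ ℂ) :
    (aeval f p).totalDegree ≤ p.totalDegree * d := by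
  rw [aeval_def, eval₂_eq]
  apply totalDegree_finsetSum_le
  intro m hm
  refine (totalDegree_mul _ _).trans ?_
  rw [MvPolynomial.algebraMap_eq, totalDegree_C, zero_add]
  refine (totalDegree_finsetProd _ _).trans ?_
  refine le_trans ?_ (Nat.mul_le_mul_right d (le_totalDegree hm))
  rw [Finsupp.sum, Finset.sum_mul]
  apply Finset.sum_le_sum
  intro i _
  exact (totalDegree_pow _ _).trans (Nat.mul_le_mul_left _ (hf i))

lemma exists_cover {τ A : Type} [Fintype τ] [Finite A] (g : A → MvPolynomial τ ℂ) (d : ℕ)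
    (hd : 1 ≤ d) (hg : ∀ a, (g a).totalDegree ≤ d) :
    ∃ (J : Type) (_ : Finite J) (P : Ideal (MvPolynomial (A ⊕ J) ℂ)), P.IsPrime ∧
      pdim P = Fintype.card τ ∧ (∀ δ, GoodC P δ → δ ≤ (d : ℝ) ^ Fintype.card τ) ∧
      ∀ w : A → ℂ, (∀ F : MvPolynomial A ℂ, aeval g F = 0 → eval w F = 0) →
        InV P (Sum.elim w (fun _ => 0)) := by
  classical
  let R₀ : Subalgebra ℂ (MvPolynomial τ ℂ) := (aeval g).range
  obtain ⟨J, hJ, hb, halg⟩ := exists_tb R₀ (Set.range (X : τ → MvPolynomial τ ℂ)) adjoin_range_X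
  have hJfin : Finite J := (Set.finite_range X).subset hJ
  let φ : MvPolynomial (A ⊕ J) ℂ →ₐ[ℂ] MvPolynomial τ ℂ :=
    aeval (Sum.elim g (fun j : J => (j : MvPolynomial τ ℂ)))
  have hdeg : ∀ x, ((Sum.elim g (fun j : J => (j : MvPolynomial τ ℂ))) x).totalDegree ≤ d := by
    rintro (a | j)
    · exact hg a
    · obtain ⟨i, hi⟩ := hJ j.2
      simp only [Sum.elim_inr, ← hi]
      rw [totalDegree_X]; exact hd
  have hprime : (RingHom.ker φ).IsPrime := RingHom.ker_isPrime _
  have hpd : pdim (RingHom.ker φ) = Fintype.card τ := by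
    have e : (MvPolynomial (A ⊕ J) ℂ ⧸ RingHom.ker φ) ≃ₐ[ℂ] φ.range :=
      Ideal.quotientKerEquivRange φ
    have hal : Algebra.IsAlgebraic φ.range (MvPolynomial τ ℂ) := by
      have h3 : R₀ ⊔ Algebra.adjoin ℂ J = φ.range := by
        simp only [R₀, φ, ← Algebra.adjoin_range_eq_range_aeval, Set.Sum.elim_range, Algebra.adjoin_union,
          Subtype.range_coe]
      rw [h3] at halg
      exact halg
    have h1 := trdeg_sub_eq φ.range
    unfold pdim
    rw [e.trdeg_eq, h1]
    simp
  refine ⟨J, hJfin, RingHom.ker φ, hprime, hpd, ?_, ?_⟩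
  · rintro δ ⟨hδ, c, hc⟩
    rw [hpd] at hc
    refine le_of_choose_growth δ hδ _ c d fun s => (hc s).trans ?_
    have : hilb (RingHom.ker φ) (s + c) ≤ Module.finrank ℂ (restrictTotalDegree τ ℂ ((s + c) * d)) := by
      unfold hilb
      rw [← LinearMap.range_domRestrict]
      refine (finrank_range_le_of_ker_le
        (φ.toLinearMap.domRestrict (restrictTotalDegree (A ⊕ J) ℂ (s + c))) _ ?_).trans ?_
      · intro x hx
        simp only [LinearMap.mem_ker, LinearMap.domRestrict_apply, Submodule.mkQ_apply,
          Submodule.Quotient.mk_eq_zero] at hx ⊢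
        exact hx
      · apply Submodule.finrank_mono
        rintro _ ⟨x, rfl⟩
        have hx := x.2
        rw [mem_restrictTotalDegree] at hx ⊢
        exact (totalDegree_aeval_le' _ d hdeg _).trans (Nat.mul_le_mul_right d hx)
    exact_mod_cast this.trans (finrank_restrict_le _)
  · intro w hw F hF
    let g' : A → R₀ := fun a => ⟨g a, ⟨X a, by simp⟩⟩
    let G : MvPolynomial (A ⊕ J) ℂ →ₐ[ℂ] MvPolynomial J R₀ :=
      aeval (Sum.elim (fun a => C (g' a)) X)
    have hG : ((aeval (R := R₀) (fun j : J => (j : MvPolynomial τ ℂ))).restrictScalars ℂ).comp G = φ := by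
      apply MvPolynomial.algHom_ext
      rintro (a | j) <;> simp [G, φ, g']
    have hGF : G F = 0 := by
      apply hb
      rw [map_zero]
      have := DFunLike.congr_fun hG F
      exact this.trans hF
    have h0 : aeval g (aeval (Sum.elim X (fun _ => 0)) F : MvPolynomial A ℂ) = 0 := by
      have hc : (aeval g).comp (aeval (Sum.elim X (fun _ : J => 0)) : MvPolynomial (A ⊕ J) ℂ →ₐ[ℂ] MvPolynomial A ℂ)
         = ((R₀.val).comp ((aeval (R := R₀) (fun j : J => (0 : R₀))).restrictScalars ℂ)).comp G := by
        apply MvPolynomial.algHom_ext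
        rintro (a | j) <;> simp [G, g']
      have := DFunLike.congr_fun hc F
      simp only [AlgHom.comp_apply] at this
      rw [this, hGF]; simp
    have := hw _ h0
    have hc : (aeval w).comp (aeval (Sum.elim X (fun _ : J => 0)) : MvPolynomial (A ⊕ J) ℂ →ₐ[ℂ] MvPolynomial A ℂ)
        = aeval (Sum.elim w (fun _ => 0)) := by
      apply MvPolynomial.algHom_ext
      rintro (a | j) <;> simp
    have h2 := DFunLike.congr_fun hc F
    simp only [AlgHom.comp_apply, aeval_eq_eval] at h2
    exact h2.symm.trans this
end

section
open MvPolynomial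

lemma zclos_eval {ι : Type} {S : Set (ι → ℂ)} {v : ι → ℂ} (hv : v ∈ zClosure S)
    (F : MvPolynomial ι ℂ) (hF : ∀ o ∈ S, eval o F = 0) : eval v F = 0 := by
  have h := hv {x | ∀ f ∈ ({F} : Set (MvPolynomial ι ℂ)), eval x f = 0}
    ⟨⟨{F}, rfl⟩, fun o ho => by simpa using hF o ho⟩
  exact h F rfl

lemma zclos_pair {ι : Type} {S : Set (ι → ℂ)} {v w : ι → ℂ} (hv : v ∈ zClosure S)
    (hw : w ∈ zClosure S) (F : MvPolynomial (ι ⊕ ι) ℂ)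
    (hF : ∀ o ∈ S, ∀ o' ∈ S, eval (Sum.elim o o') F = 0) : eval (Sum.elim v w) F = 0 := by
  have e1 : ∀ x y : ι → ℂ, eval x (aeval (Sum.elim X (fun i => C (y i))) F) = eval (Sum.elim x y) F := by
    intro x y
    have hc : (aeval x).comp (aeval (Sum.elim X (fun i => C (y i))) :
        MvPolynomial (ι ⊕ ι) ℂ →ₐ[ℂ] MvPolynomial ι ℂ) = aeval (Sum.elim x y) := by
      apply MvPolynomial.algHom_ext
      rintro (a | j) <;> simp
    have h2 := DFunLike.congr_fun hc F
    simpa only [AlgHom.comp_apply, aeval_eq_eval] using h2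
  have e2 : ∀ x y : ι → ℂ, eval y (aeval (Sum.elim (fun i => C (x i)) X) F) = eval (Sum.elim x y) F := by
    intro x y
    have hc : (aeval y).comp (aeval (Sum.elim (fun i => C (x i)) X) :
        MvPolynomial (ι ⊕ ι) ℂ →ₐ[ℂ] MvPolynomial ι ℂ) = aeval (Sum.elim x y) := by
      apply MvPolynomial.algHom_ext
      rintro (a | j) <;> simp
    have h2 := DFunLike.congr_fun hc F
    simpa only [AlgHom.comp_apply, aeval_eq_eval] using h2
  rw [← e1]
  apply zclos_eval hv
  intro o ho
  rw [e1, ← e2]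
  apply zclos_eval hw
  intro o' ho'
  rw [e2]
  exact hF o ho o' ho'

lemma totalDegree_aux {L : ℕ} {τ : Type} (f : Fin L → τ) (p : MvPolynomial (Fin L) ℚ) :
    (rename f (map (algebraMap ℚ ℂ) p)).totalDegree ≤ p.totalDegree :=
  (totalDegree_rename_le _ _).trans (Finset.sup_mono (support_map_subset _ _))

lemma bad_bound (t L Δ Δ2 m : ℕ) (hΔ2 : 1 ≤ Δ2) (D : Set (Fin L → ℂ))
    (Ω : (Fin t → Fin (Δ + 1)) → MvPolynomial (Fin L) ℚ)
    (hΩdeg : ∀ α, (Ω α).totalDegree ≤ Δ2)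
    (hΩsupp : ∀ α : Fin t → Fin (Δ + 1), Δ < ∑ i : Fin t, (α i : ℕ) → Ω α = 0)
    (M : Finset ℚ) (hM2 : 2 ≤ M.card) :
    ({γ : Fin m → Fin t → {x : ℚ // x ∈ M} |
          ¬ ∀ v₁ ∈ zClosure (objClass t L Δ D Ω), ∀ v₂ ∈ zClosure (objClass t L Δ D Ω),
              (∀ i : Fin m,
                evalVec v₁ (fun j => ((γ i j : ℚ) : ℂ)) =
                  evalVec v₂ (fun j => ((γ i j : ℚ) : ℂ))) → v₁ = v₂}.ncard : ℝ) ≤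
      (Δ2 : ℝ) ^ (2 * L) * (M.card : ℝ) ^ (2 * L) * (2 * (Δ * (M.card : ℝ) ^ (t - 1)) ^ m) := by
  classical
  let g : (Fin t → Fin (Δ + 1)) ⊕ (Fin t → Fin (Δ + 1)) → MvPolynomial (Fin L ⊕ Fin L) ℂ :=
    Sum.elim (fun α => rename Sum.inl (map (algebraMap ℚ ℂ) (Ω α)))
      (fun α => rename Sum.inr (map (algebraMap ℚ ℂ) (Ω α)))
  have hg : ∀ a, (g a).totalDegree ≤ Δ2 := by
    rintro (α | α)
    · exact (totalDegree_aux _ _).trans (hΩdeg α)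
    · exact (totalDegree_aux _ _).trans (hΩdeg α)
  obtain ⟨J, hJ, P, hP, hpd, hgood, hlift⟩ := exists_cover g Δ2 hΔ2 hg
  have hcard : Fintype.card (Fin L ⊕ Fin L) = 2 * L := by simp; ring
  rw [hcard] at hpd hgood
  let a : (Fin t → Fin (Δ + 1)) →
      MvPolynomial (((Fin t → Fin (Δ + 1)) ⊕ (Fin t → Fin (Δ + 1))) ⊕ J) ℂ :=
    fun α => if Δ < ∑ i, (α i : ℕ) then 0 else X (Sum.inl (Sum.inl α)) - X (Sum.inl (Sum.inr α))
  have ha : ∀ α, (a α).totalDegree ≤ 1 := by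
    intro α
    simp only [a]
    split_ifs
    · simp
    · refine (totalDegree_sub _ _).trans ?_
      simp
  have hs : ∀ α : Fin t → Fin (Δ + 1), Δ < ∑ i, (α i : ℕ) → a α = 0 := by
    intro α hα
    simp [a, hα]
  let v : {x : ℚ // x ∈ M} → ℂ := fun x => ((x : ℚ) : ℂ)
  have hv : Function.Injective v := by
    intro x y h
    simp only [v] at h
    exact Subtype.ext (by exact_mod_cast h)
  have hY : Fintype.card {x : ℚ // x ∈ M} = M.card := Fintype.card_coe M
  obtain ⟨δ, hδ, hb⟩ := strata_bound (by rw [hY]; exact hM2) v hv a ha hs m (2 * L) P hP hpd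
  rw [hpd, hY] at hb
  have hsub : {γ : Fin m → Fin t → {x : ℚ // x ∈ M} |
          ¬ ∀ v₁ ∈ zClosure (objClass t L Δ D Ω), ∀ v₂ ∈ zClosure (objClass t L Δ D Ω),
              (∀ i : Fin m,
                evalVec v₁ (fun j => ((γ i j : ℚ) : ℂ)) =
                  evalVec v₂ (fun j => ((γ i j : ℚ) : ℂ))) → v₁ = v₂} ⊆
      wset (fun u (γ : Fin m → Fin t → {x : ℚ // x ∈ M}) =>
        (∃ α, eval u (a α) ≠ 0) ∧ ∀ i, fval v a u (γ i) = 0) P := by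
    intro γ hγ
    simp only [Set.mem_ofPred_eq] at hγ
    push Not at hγ
    obtain ⟨v₁, h₁, v₂, h₂, hev, hne⟩ := hγ
    have hz : ∀ w ∈ zClosure (objClass t L Δ D Ω), ∀ α : Fin t → Fin (Δ + 1),
        Δ < ∑ i, (α i : ℕ) → w α = 0 := by
      intro w hw α hα
      have := zclos_eval hw (X α) (by
        rintro o ⟨c, -, rfl⟩
        simp [hΩsupp α hα])
      simpa using this
    have hea : ∀ α, eval (Sum.elim (Sum.elim v₁ v₂) (fun _ : J => (0 : ℂ))) (a α) = v₁ α - v₂ α := by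
      intro α
      simp only [a]
      split_ifs with h
      · simp [hz v₁ h₁ α h, hz v₂ h₂ α h]
      · simp
    refine ⟨Sum.elim (Sum.elim v₁ v₂) (fun _ => 0), ?_, ?_, ?_⟩
    · apply hlift
      intro F hF
      apply zclos_pair h₁ h₂
      rintro o ⟨c, -, rfl⟩ o' ⟨c', -, rfl⟩
      have hc : (aeval (Sum.elim c c')).comp (aeval g) =
          (aeval (Sum.elim (fun α => aeval c (Ω α)) (fun α => aeval c' (Ω α))) :
            MvPolynomial ((Fin t → Fin (Δ + 1)) ⊕ (Fin t → Fin (Δ + 1))) ℂ →ₐ[ℂ] ℂ) := by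
        apply MvPolynomial.algHom_ext
        rintro (α | α)
        · simp only [g, AlgHom.comp_apply, aeval_X, Sum.elim_inl, Sum.elim_inr, aeval_rename,
            aeval_map_algebraMap, Sum.elim_comp_inl, Sum.elim_comp_inr]
        · simp only [g, AlgHom.comp_apply, aeval_X, Sum.elim_inl, Sum.elim_inr, aeval_rename,
            aeval_map_algebraMap, Sum.elim_comp_inl, Sum.elim_comp_inr]
      have h2 := DFunLike.congr_fun hc F
      rw [AlgHom.comp_apply, hF, map_zero, aeval_eq_eval] at h2
      exact h2.symm
    · by_contra hcon
      push Not at hcon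
      apply hne
      funext α
      have := hcon α
      rw [hea] at this
      exact sub_eq_zero.1 this
    · intro i
      unfold fval
      simp only [hea, sub_mul, Finset.sum_sub_distrib]
      exact sub_eq_zero.2 (hev i)
  have h1 : ((_ : Set (Fin m → Fin t → {x : ℚ // x ∈ M})).ncard : ℝ) ≤ _ :=
    Nat.cast_le.2 (Set.ncard_le_ncard hsub (Set.toFinite _))
  refine h1.trans (hb.trans ?_)
  push_cast
  gcongr
  exact hgood δ hδ

lemma final_arith (t L K Δ Δ1 Δ2 m N : ℕ) (ht : 1 ≤ t) (hL : 1 ≤ L) (hΔ : 1 ≤ Δ) (hΔ2 : 1 ≤ Δ2)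
    (hm : 4 * L + 2 ≤ m)
    (hMbig : (Δ : ℝ) ^ 2 * ((L : ℝ) + 1) ^ ((1 : ℝ) / (L : ℝ)) *
        (1 + (K : ℝ) * (Δ1 : ℝ)) * (Δ2 : ℝ) ≤ (N : ℝ)) :
    (Δ2 : ℝ) ^ (2 * L) * (N : ℝ) ^ (2 * L) * (2 * (Δ * (N : ℝ) ^ (t - 1)) ^ m) ≤
      (N : ℝ) ^ (m * t - 1) := by
  obtain ⟨j, rfl⟩ := Nat.exists_eq_add_of_le hm
  obtain ⟨r, rfl⟩ := Nat.exists_eq_add_of_le ht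
  set e : ℝ := ((L : ℝ) + 1) ^ ((1 : ℝ) / (L : ℝ)) with he
  have hL' : (1 : ℝ) ≤ L := by exact_mod_cast hL
  have hΔ' : (1 : ℝ) ≤ Δ := by exact_mod_cast hΔ
  have hΔ2' : (1 : ℝ) ≤ Δ2 := by exact_mod_cast hΔ2
  have heL : e ^ L = (L : ℝ) + 1 := by
    rw [he, ← Real.rpow_natCast, ← Real.rpow_mul (by positivity), one_div_mul_cancel (by positivity),
      Real.rpow_one]
  have he1 : 1 ≤ e := Real.one_le_rpow (by linarith) (by positivity)
  have h1 : (Δ : ℝ) ^ 2 * e * Δ2 ≤ N := by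
    refine le_trans ?_ hMbig
    have : (1 : ℝ) ≤ 1 + (K : ℝ) * (Δ1 : ℝ) := by
      have : (0 : ℝ) ≤ (K : ℝ) * (Δ1 : ℝ) := by positivity
      linarith
    have h0 : (0 : ℝ) ≤ (Δ : ℝ) ^ 2 * e := by positivity
    calc (Δ : ℝ) ^ 2 * e * Δ2 = (Δ : ℝ) ^ 2 * e * 1 * Δ2 := by ring
      _ ≤ _ := by gcongr
  have h2 : (Δ : ℝ) ^ 2 ≤ N := by
    refine le_trans ?_ h1
    have : 1 ≤ e * Δ2 := one_le_mul_of_one_le_of_one_le he1 hΔ2'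
    nlinarith [sq_nonneg (Δ : ℝ)]
  have h3 : (Δ : ℝ) ≤ N := by nlinarith
  have h4 : (Δ : ℝ) ^ (4 * L) * 2 * (Δ2 : ℝ) ^ (2 * L) ≤ (N : ℝ) ^ (2 * L) := by
    calc (Δ : ℝ) ^ (4 * L) * 2 * (Δ2 : ℝ) ^ (2 * L)
        ≤ (Δ : ℝ) ^ (4 * L) * ((L : ℝ) + 1) ^ 2 * (Δ2 : ℝ) ^ (2 * L) := by
          gcongr; nlinarith
      _ = ((Δ : ℝ) ^ 2 * e * Δ2) ^ (2 * L) := by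
          rw [← heL, mul_pow, mul_pow, ← pow_mul, ← pow_mul]
          congr 3 <;> ring
      _ ≤ _ := by gcongr
  have hexp : (4 * L + 2 + j) * (1 + r) - 1 = r * (4 * L + 2 + j) + (4 * L + 1 + j) := by
    have : (4 * L + 2 + j) * (1 + r) = r * (4 * L + 2 + j) + (4 * L + 1 + j) + 1 := by ring
    omega
  rw [hexp, show 1 + r - 1 = r by omega]
  calc (Δ2 : ℝ) ^ (2 * L) * (N : ℝ) ^ (2 * L) * (2 * (Δ * (N : ℝ) ^ r) ^ (4 * L + 2 + j))
      = (N : ℝ) ^ (r * (4 * L + 2 + j)) * ((N : ℝ) ^ (2 * L) *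
          ((Δ : ℝ) ^ (4 * L) * 2 * (Δ2 : ℝ) ^ (2 * L)) * ((Δ : ℝ) ^ 2 * (Δ : ℝ) ^ j)) := by
        rw [mul_pow, ← pow_mul]; ring
    _ ≤ (N : ℝ) ^ (r * (4 * L + 2 + j)) * ((N : ℝ) ^ (2 * L) * (N : ℝ) ^ (2 * L) * (N * (N : ℝ) ^ j)) := by
        gcongr
    _ = _ := by ring
end

/-- Existence (and abundance) of identification sequences of length `m ≥ 4L+2`
with entries in a sufficiently large finite set `M ⊆ ℚ` for the Zariski closure
`Ō` of a holomorphically encoded `ℚ`-constructible object class `O` of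
`t`-variate polynomials of degree at most `Δ`. -/
theorem identification_sequence_exists
    (t L K Δ Δ1 Δ2 m : ℕ)
    (ht : 1 ≤ t) (hL : 1 ≤ L) (hK : 1 ≤ K) (hΔ : 1 ≤ Δ) (hΔ2 : 1 ≤ Δ2)
    (hm : 4 * L + 2 ≤ m)
    (G : Fin K → MvPolynomial (Fin L) ℚ) (hG : ∀ i, (G i).totalDegree ≤ Δ1)
    (D : Set (Fin L → ℂ))
    (hD : InBoolAlg
      (Set.range fun i : Fin K => {c : Fin L → ℂ | MvPolynomial.aeval c (G i) = 0}) D)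
    (Ω : (Fin t → Fin (Δ + 1)) → MvPolynomial (Fin L) ℚ)
    (hΩdeg : ∀ α, (Ω α).totalDegree ≤ Δ2)
    (hΩsupp : ∀ α : Fin t → Fin (Δ + 1), Δ < ∑ i : Fin t, (α i : ℕ) → Ω α = 0)
    (M : Finset ℚ) (hM2 : 2 ≤ M.card)
    (hMbig : (Δ : ℝ) ^ 2 * ((L : ℝ) + 1) ^ ((1 : ℝ) / (L : ℝ)) *
        (1 + (K : ℝ) * (Δ1 : ℝ)) * (Δ2 : ℝ) ≤ (M.card : ℝ)) :
    (∃ γ : Fin m → Fin t → ℚ, (∀ i j, γ i j ∈ M) ∧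
        ∀ v₁ ∈ zClosure (objClass t L Δ D Ω), ∀ v₂ ∈ zClosure (objClass t L Δ D Ω),
          (∀ i : Fin m,
            evalVec v₁ (fun j => ((γ i j : ℚ) : ℂ)) =
              evalVec v₂ (fun j => ((γ i j : ℚ) : ℂ))) → v₁ = v₂) ∧
      {γ : Fin m → Fin t → {x : ℚ // x ∈ M} |
          ¬ ∀ v₁ ∈ zClosure (objClass t L Δ D Ω), ∀ v₂ ∈ zClosure (objClass t L Δ D Ω),
              (∀ i : Fin m,
                evalVec v₁ (fun j => ((γ i j : ℚ) : ℂ)) =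
                  evalVec v₂ (fun j => ((γ i j : ℚ) : ℂ))) → v₁ = v₂}.ncard
        ≤ M.card ^ (m * t - 1) := by
  have hbad := (bad_bound t L Δ Δ2 m hΔ2 D Ω hΩdeg hΩsupp M hM2).trans
    (final_arith t L K Δ Δ1 Δ2 m M.card ht hL hΔ hΔ2 hm hMbig)
  rw [← Nat.cast_pow, Nat.cast_le] at hbad
  refine ⟨?_, hbad⟩
  by_contra hcon
  push Not at hcon
  have huniv : {γ : Fin m → Fin t → {x : ℚ // x ∈ M} |
          ¬ ∀ v₁ ∈ zClosure (objClass t L Δ D Ω), ∀ v₂ ∈ zClosure (objClass t L Δ D Ω),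
              (∀ i : Fin m,
                evalVec v₁ (fun j => ((γ i j : ℚ) : ℂ)) =
                  evalVec v₂ (fun j => ((γ i j : ℚ) : ℂ))) → v₁ = v₂} = Set.univ := by
    rw [Set.eq_univ_iff_forall]
    intro γ
    obtain ⟨v₁, h₁, v₂, h₂, h, hne⟩ := hcon (fun i j => (γ i j : ℚ)) (fun i j => (γ i j).2)
    exact fun hall => hne (hall v₁ h₁ v₂ h₂ h)
  rw [huniv, Set.ncard_univ] at hbad
  have hc : Nat.card (Fin m → Fin t → {x : ℚ // x ∈ M}) = M.card ^ (m * t) := by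
    rw [Nat.card_eq_fintype_card]
    simp only [Fintype.card_pi, Fintype.card_coe, Finset.prod_const, Finset.card_univ, Fintype.card_fin]
    rw [← pow_mul, mul_comm]
  rw [hc] at hbad
  have hpos : 1 ≤ m * t := Nat.mul_pos (by omega) ht
  exact absurd hbad (not_le.2 (Nat.pow_lt_pow_right (by omega) (by omega)))
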